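/- There is a constant C > 0, independent of T, ψ and v, with the following property. Let ψ : [0,T]×ℝ³ → ℝ and v : [0,T]×ℝ³ → ℝ³ be smooth, Schwartz in the space variable for each t, with div v = 0 and satisfying the transport equation ∂_tψ + v·∇ψ + v₃ = 0 on [0,T]×ℝ³. Then |∫₀^T (v·∇ψ | Δψ)_{H²} dt| ≤ C B_T³ (1 + B_T)². -/

import Mathlib

open MeasureTheory Real Set Filter
open scoped ENNReal NNReal

noncomputable section

/-- Spatial points of `ℝ³`. -/
abbrev Pt : Type := Fin 3 → ℝ

/-- Partial derivative in the `i`-th coordinate direction. -/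
def pd (i : Fin 3) (f : Pt → ℝ) : Pt → ℝ := fun x => fderiv ℝ f x (Pi.single i 1)

/-- Iterated partial derivative `∂^α` for a multi-index `α`. -/
def pdM (α : Fin 3 → ℕ) (f : Pt → ℝ) : Pt → ℝ :=
  (pd 0)^[α 0] ((pd 1)^[α 1] ((pd 2)^[α 2] f))

/-- Multi-indices of total degree at most `k`. -/
def midx (k : ℕ) : Finset (Fin 3 → ℕ) :=
  (Fintype.piFinset fun _ => Finset.range (k + 1)).filter fun α => ∑ i, α i ≤ k

/-- The `H^k` inner product `(f|g)_{H^k} = ∑_{|α| ≤ k} ∫ ∂^α f ∂^α g`. -/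
def hInner (k : ℕ) (f g : Pt → ℝ) : ℝ := ∑ α ∈ midx k, ∫ x : Pt, pdM α f x * pdM α g x

/-- The squared `H^k` norm. -/
def hSq (k : ℕ) (f : Pt → ℝ) : ℝ := hInner k f f

/-- The squared `L²` norm. -/
def l2Sq (f : Pt → ℝ) : ℝ := ∫ x : Pt, (f x) ^ 2

/-- The Laplacian. -/
def lapl (f : Pt → ℝ) : Pt → ℝ := fun x => ∑ i, pd i (pd i f) x

/-- Horizontal directions. -/
def hIdx : Finset (Fin 3) := {0, 1}

/-- `L^∞` norm in time over `[0,T]` of a (nonnegative) function of time. -/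
def supT (T : ℝ) (g : ℝ → ℝ) : ℝ := sSup (g '' Icc 0 T)

/-- `L²` norm in time over `[0,T]`. -/
def l2T (T : ℝ) (g : ℝ → ℝ) : ℝ := Real.sqrt (∫ t in (0:ℝ)..T, (g t) ^ 2)

/-- `L⁴` norm in time over `[0,T]`. -/
def l4T (T : ℝ) (g : ℝ → ℝ) : ℝ := (∫ t in (0:ℝ)..T, (g t) ^ 4) ^ ((1:ℝ)/4)

/-- A function is Schwartz: smooth with all derivatives rapidly decaying. -/
def IsSchwartz (f : Pt → ℝ) : Prop :=
  ContDiff ℝ (⊤ : ℕ∞) f ∧ ∀ k n : ℕ, ∃ C : ℝ, ∀ x, ‖x‖ ^ k * ‖iteratedFDeriv ℝ n f x‖ ≤ C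

/-- Smoothness of `f` jointly in `(t,x)` on `s ×ˢ ℝ³`. -/
def SmoothOn2 (s : Set ℝ) (f : ℝ → Pt → ℝ) : Prop :=
  ContDiffOn ℝ (⊤ : ℕ∞) (fun q : ℝ × Pt => f q.1 q.2) (s ×ˢ (univ : Set Pt))

/-- `‖∇f‖_{H^k}²`. -/
def gradHSq (k : ℕ) (f : Pt → ℝ) : ℝ := ∑ i, hSq k (pd i f)

/-- `‖∇_h∇f‖_{H^k}²`. -/
def gradHHSq (k : ℕ) (f : Pt → ℝ) : ℝ := ∑ i ∈ hIdx, ∑ j, hSq k (pd i (pd j f))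

/-- `‖v‖_{H^k}²` for a vector field. -/
def vecHSq (k : ℕ) (v : Fin 3 → Pt → ℝ) : ℝ := ∑ j, hSq k (v j)

/-- `‖∇v‖_{H^k}²` for a vector field. -/
def gradVecHSq (k : ℕ) (v : Fin 3 → Pt → ℝ) : ℝ := ∑ j, gradHSq k (v j)

/-- `B_T²`. -/
def BTsq (T : ℝ) (ψ : ℝ → Pt → ℝ) (v : Fin 3 → ℝ → Pt → ℝ) : ℝ :=
  (supT T fun t => Real.sqrt (vecHSq 2 fun j => v j t)) ^ 2
  + (supT T fun t => Real.sqrt (gradHSq 2 (ψ t))) ^ 2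
  + (l2T T fun t => Real.sqrt (gradVecHSq 2 fun j => v j t)) ^ 2
  + (l2T T fun t => Real.sqrt (gradHHSq 1 (ψ t))) ^ 2

/-- `B_T`. -/
def BT (T : ℝ) (ψ : ℝ → Pt → ℝ) (v : Fin 3 → ℝ → Pt → ℝ) : ℝ := Real.sqrt (BTsq T ψ v)

/-- The transport equation `∂_tψ + v·∇ψ + v₃ = 0` on `s × ℝ³`. -/
def TransportEq (s : Set ℝ) (ψ : ℝ → Pt → ℝ) (v : Fin 3 → ℝ → Pt → ℝ) : Prop :=
  ∀ t ∈ s, ∀ x, deriv (fun τ => ψ τ x) t + (∑ i, v i t x * pd i (ψ t) x) + v 2 t x = 0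

/-- Divergence-free condition on `s × ℝ³`. -/
def DivFree (s : Set ℝ) (v : Fin 3 → ℝ → Pt → ℝ) : Prop :=
  ∀ t ∈ s, ∀ x, (∑ i, pd i (fun y => v i t y) x) = 0

/-- The momentum equations of system (S) on `s × ℝ³`. -/
def MomentumEq (s : Set ℝ) (ψ : ℝ → Pt → ℝ) (v : Fin 3 → ℝ → Pt → ℝ)
    (p : ℝ → Pt → ℝ) : Prop :=
  ∀ j : Fin 3, ∀ t ∈ s, ∀ x,
    deriv (fun τ => v j τ x) t + (∑ i, v i t x * pd i (v j t) x) - lapl (v j t) x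
      + pd j (p t) x + pd j (pd 2 (ψ t)) x + (if j = 2 then lapl (ψ t) x else 0)
    = - ∑ i, pd i (fun y => pd j (ψ t) y * pd i (ψ t) y) x

/-- The full system (S) on `s × ℝ³`. -/
def SolvesS (s : Set ℝ) (ψ : ℝ → Pt → ℝ) (v : Fin 3 → ℝ → Pt → ℝ)
    (p : ℝ → Pt → ℝ) : Prop :=
  TransportEq s ψ v ∧ MomentumEq s ψ v p ∧ DivFree s v

/-- Finiteness of the four norms entering `B_T`. -/
def FiniteClass (T : ℝ) (ψ : ℝ → Pt → ℝ) (v : Fin 3 → ℝ → Pt → ℝ) : Prop :=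
  BddAbove ((fun t => Real.sqrt (vecHSq 2 fun j => v j t)) '' Icc 0 T) ∧
  BddAbove ((fun t => Real.sqrt (gradHSq 2 (ψ t))) '' Icc 0 T) ∧
  IntervalIntegrable (fun t => gradVecHSq 2 fun j => v j t) volume 0 T ∧
  IntervalIntegrable (fun t => gradHHSq 1 (ψ t)) volume 0 T

/-! ### Schwartz functions and their partial derivatives -/

namespace IsSchwartz

variable {f g : Pt → ℝ}

theorem exists_map (hf : IsSchwartz f) : ∃ φ : SchwartzMap Pt ℝ, (φ : Pt → ℝ) = f :=
  ⟨⟨f, hf.1, hf.2⟩, rfl⟩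

theorem of_map (φ : SchwartzMap Pt ℝ) : IsSchwartz φ := ⟨φ.smooth _, φ.decay'⟩

theorem add (hf : IsSchwartz f) (hg : IsSchwartz g) : IsSchwartz fun x => f x + g x := by
  obtain ⟨φ, rfl⟩ := hf.exists_map
  obtain ⟨χ, rfl⟩ := hg.exists_map
  exact of_map (φ + χ)

theorem mul (hf : IsSchwartz f) (hg : IsSchwartz g) : IsSchwartz fun x => f x * g x := by
  obtain ⟨φ, rfl⟩ := hf.exists_map
  obtain ⟨χ, rfl⟩ := hg.exists_map
  exact of_map (SchwartzMap.pairing (ContinuousLinearMap.mul ℝ ℝ) φ χ)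

theorem const_mul (c : ℝ) (hf : IsSchwartz f) : IsSchwartz fun x => c * f x := by
  obtain ⟨φ, rfl⟩ := hf.exists_map
  exact of_map (c • φ)

theorem sub (hf : IsSchwartz f) (hg : IsSchwartz g) : IsSchwartz fun x => f x - g x := by
  obtain ⟨φ, rfl⟩ := hf.exists_map
  obtain ⟨χ, rfl⟩ := hg.exists_map
  exact of_map (φ - χ)

theorem zero : IsSchwartz fun _ => 0 := of_map 0

theorem sum {ι : Type*} (s : Finset ι) {F : ι → Pt → ℝ} (h : ∀ i, IsSchwartz (F i)) :
    IsSchwartz fun x => ∑ i ∈ s, F i x := by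
  classical
  induction s using Finset.induction_on with
  | empty => simpa using zero
  | insert a s ha ih => simpa [Finset.sum_insert ha] using (h a).add ih

theorem pow (hf : IsSchwartz f) (n : ℕ) : IsSchwartz fun x => f x ^ (n + 1) := by
  induction n with
  | zero => simpa using hf
  | succ n ih => simpa [pow_succ] using ih.mul hf

theorem pd (hf : IsSchwartz f) (i : Fin 3) : IsSchwartz (pd i f) := by
  obtain ⟨φ, rfl⟩ := hf.exists_map
  exact of_map (SchwartzMap.evalCLM ℝ Pt ℝ (Pi.single i 1) (SchwartzMap.fderivCLM ℝ Pt ℝ φ))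

theorem integrable (hf : IsSchwartz f) : Integrable f := by
  obtain ⟨φ, rfl⟩ := hf.exists_map
  exact φ.integrable

theorem continuous (hf : IsSchwartz f) : Continuous f := hf.1.continuous

theorem differentiable (hf : IsSchwartz f) : Differentiable ℝ f :=
  hf.1.differentiable (by simp)

end IsSchwartz

section Derivatives

variable {f g : Pt → ℝ}

theorem pd_add (i : Fin 3) (hf : IsSchwartz f) (hg : IsSchwartz g) :
    pd i (fun x => f x + g x) = fun x => pd i f x + pd i g x := by
  funext x
  simp [pd, fderiv_fun_add (hf.differentiable x) (hg.differentiable x)]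

theorem pd_mul (i : Fin 3) (hf : IsSchwartz f) (hg : IsSchwartz g) :
    pd i (fun x => f x * g x) = fun x => pd i f x * g x + f x * pd i g x := by
  funext x
  simp [pd, fderiv_fun_mul (hf.differentiable x) (hg.differentiable x)]
  ring

theorem pd_const_mul (i : Fin 3) (c : ℝ) (hf : IsSchwartz f) :
    pd i (fun x => c * f x) = fun x => c * pd i f x := by
  funext x
  simp [pd, fderiv_const_mul (hf.differentiable x)]

theorem pd_sum {ι : Type*} (s : Finset ι) (i : Fin 3) {F : ι → Pt → ℝ}
    (h : ∀ j, IsSchwartz (F j)) :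
    pd i (fun x => ∑ j ∈ s, F j x) = fun x => ∑ j ∈ s, pd i (F j) x := by
  funext x
  simp [pd, fderiv_fun_sum fun j _ => (h j).differentiable x]

theorem pd_pow (i : Fin 3) (n : ℕ) (hf : IsSchwartz f) :
    pd i (fun x => f x ^ n) = fun x => n * f x ^ (n - 1) * pd i f x := by
  funext x
  simp [pd, fderiv_fun_pow n (hf.differentiable x)]

theorem pd_comm (i j : Fin 3) (hf : ContDiff ℝ (⊤ : ℕ∞) f) : pd i (pd j f) = pd j (pd i f) := by
  funext x
  have h1 : ContDiff ℝ 1 (fderiv ℝ f) := (hf.of_le (m := 2) (by norm_cast)).fderiv_right (by norm_num)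
  have h2 : DifferentiableAt ℝ (fderiv ℝ f) x := h1.differentiable (by simp) x
  have h3 : IsSymmSndFDerivAt ℝ f x :=
    (hf.of_le (m := 2) (by norm_cast)).contDiffAt.isSymmSndFDerivAt (by simp)
  have key : ∀ i j : Fin 3, pd i (pd j f) x
      = fderiv ℝ (fderiv ℝ f) x (Pi.single i 1) (Pi.single j 1) := by
    intro i j
    have : fderiv ℝ (fun y => fderiv ℝ f y (Pi.single j 1)) x = _ :=
      fderiv_clm_apply h2 (differentiableAt_const _)
    change fderiv ℝ (fun y => fderiv ℝ f y (Pi.single j 1)) x (Pi.single i 1) = _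
    rw [this]
    simp
  rw [key, key, h3.eq]

theorem integral_pd (i : Fin 3) (hf : IsSchwartz f) : ∫ x, pd i f x = 0 := by
  have := integral_mul_fderiv_eq_neg_fderiv_mul_of_integrable (μ := (volume : Measure Pt))
    (f := fun _ : Pt => (1 : ℝ)) (g := f) (v := Pi.single i 1) (by simp)
    (by simpa using! (hf.pd i).integrable) (by simpa using hf.integrable)
    (by simp) (fun x _ => hf.differentiable x)
  simpa [pd] using this

theorem integral_pd_mul (i : Fin 3) (hf : IsSchwartz f) (hg : IsSchwartz g) :
    ∫ x, f x * pd i g x = -∫ x, pd i f x * g x := by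
  have := integral_pd i (hf.mul hg)
  rw [pd_mul i hf hg, integral_add ((hf.pd i).mul hg).integrable (hf.mul (hg.pd i)).integrable]
    at this
  linarith

end Derivatives

/-! ### Derivatives indexed by lists of directions -/

/-- Iterated partial derivative in the directions of a list. -/
def iterPd (L : List (Fin 3)) (f : Pt → ℝ) : Pt → ℝ := L.foldr pd f

theorem iterPd_nil (f : Pt → ℝ) : iterPd [] f = f := rfl

theorem iterPd_cons (i : Fin 3) (L : List (Fin 3)) (f : Pt → ℝ) :
    iterPd (i :: L) f = pd i (iterPd L f) := rfl

theorem IsSchwartz.iterPd {f : Pt → ℝ} (hf : IsSchwartz f) (L : List (Fin 3)) :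
    IsSchwartz (iterPd L f) := by
  induction L with
  | nil => exact hf
  | cons i L ih => exact ih.pd i

theorem iterPd_append (L M : List (Fin 3)) (f : Pt → ℝ) :
    iterPd (L ++ M) f = iterPd L (iterPd M f) := by
  simp [iterPd]

theorem iterPd_perm {f : Pt → ℝ} (hf : IsSchwartz f) {L M : List (Fin 3)} (h : L.Perm M) :
    iterPd L f = iterPd M f := by
  induction h with
  | nil => rfl
  | cons i _ ih => simp only [iterPd_cons, ih]
  | swap i j L => exact pd_comm _ _ (hf.iterPd L).1
  | trans _ _ h1 h2 => exact h1.trans h2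

/-- The list of directions of a multi-index. -/
def dirs (α : Fin 3 → ℕ) : List (Fin 3) :=
  List.replicate (α 0) 0 ++ (List.replicate (α 1) 1 ++ List.replicate (α 2) 2)

theorem iterate_pd (n : ℕ) (i : Fin 3) (f : Pt → ℝ) :
    (pd i)^[n] f = iterPd (List.replicate n i) f := by
  induction n with
  | zero => rfl
  | succ n ih => rw [Function.iterate_succ_apply', ih, List.replicate_succ, iterPd_cons]

theorem pdM_eq_iterPd (α : Fin 3 → ℕ) (f : Pt → ℝ) : pdM α f = iterPd (dirs α) f := by
  simp only [pdM, iterate_pd, dirs, iterPd_append]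

theorem length_dirs (α : Fin 3 → ℕ) : (dirs α).length = ∑ i, α i := by
  simp [dirs, Fin.sum_univ_three, add_assoc]

theorem mem_midx {k : ℕ} {α : Fin 3 → ℕ} : α ∈ midx k ↔ ∑ i, α i ≤ k := by
  simp only [midx, Finset.mem_filter, Fintype.mem_piFinset, Finset.mem_range, and_iff_right_iff_imp]
  intro h i
  have := Finset.single_le_sum (f := α) (fun j _ => Nat.zero_le _) (Finset.mem_univ i)
  omega

theorem perm_dirs_count (L : List (Fin 3)) : L.Perm (dirs fun i => L.count i) := by
  rw [List.perm_iff_count]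
  intro i
  fin_cases i <;> simp [dirs, List.count_replicate]

theorem l2Sq_nonneg (f : Pt → ℝ) : 0 ≤ l2Sq f := integral_nonneg fun _ => sq_nonneg _

theorem hSq_eq (k : ℕ) (f : Pt → ℝ) : hSq k f = ∑ α ∈ midx k, l2Sq (pdM α f) := by
  simp [hSq, hInner, l2Sq, sq]

theorem hSq_nonneg (k : ℕ) (f : Pt → ℝ) : 0 ≤ hSq k f := by
  rw [hSq_eq]
  exact Finset.sum_nonneg fun _ _ => l2Sq_nonneg _

theorem l2Sq_iterPd_le {f : Pt → ℝ} (hf : IsSchwartz f) {k : ℕ} {L : List (Fin 3)}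
    (hL : L.length ≤ k) : l2Sq (iterPd L f) ≤ hSq k f := by
  rw [hSq_eq, iterPd_perm hf (perm_dirs_count L), ← pdM_eq_iterPd]
  refine Finset.single_le_sum (f := fun α => l2Sq (pdM α f)) (fun _ _ => l2Sq_nonneg _)
    (mem_midx.2 ?_)
  rw [← length_dirs, ← (perm_dirs_count L).length_eq]
  exact hL

/-! ### Sobolev-type inequalities -/

theorem sq_lintegral_mul_le {α : Type*} [MeasurableSpace α] {μ : Measure α} {f g : α → ℝ≥0∞}
    (hf : Measurable f) (hg : Measurable g) :
    (∫⁻ x, f x * g x ∂μ) ^ 2 ≤ (∫⁻ x, f x ^ 2 ∂μ) * ∫⁻ x, g x ^ 2 ∂μ := by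
  have h := ENNReal.lintegral_mul_le_Lp_mul_Lq μ (Real.HolderConjugate.two_two)
    hf.aemeasurable hg.aemeasurable
  calc (∫⁻ x, f x * g x ∂μ) ^ 2
      ≤ ((∫⁻ x, f x ^ (2 : ℝ) ∂μ) ^ (1 / 2 : ℝ) * (∫⁻ x, g x ^ (2 : ℝ) ∂μ) ^ (1 / 2 : ℝ)) ^ 2 := by
        gcongr
        exact h
    _ = _ := by
        rw [mul_pow, ← ENNReal.rpow_natCast, ← ENNReal.rpow_natCast, ← ENNReal.rpow_mul,
          ← ENNReal.rpow_mul]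
        norm_num

theorem lintegral_pow_four_le_of_isProbability {α : Type*} [MeasurableSpace α] {μ : Measure α}
    [IsProbabilityMeasure μ] {f : α → ℝ≥0∞} (hf : Measurable f) :
    (∫⁻ x, f x ∂μ) ^ 4 ≤ ∫⁻ x, f x ^ 4 ∂μ := by
  have h1 := sq_lintegral_mul_le (μ := μ) hf measurable_const (g := 1)
  have h2 := sq_lintegral_mul_le (μ := μ) (hf.pow_const 2) measurable_const (g := 1)
  simp only [Pi.one_apply, mul_one, one_pow, lintegral_const, measure_univ, ← pow_mul] at h1 h2
  calc (∫⁻ x, f x ∂μ) ^ 4 = ((∫⁻ x, f x ∂μ) ^ 2) ^ 2 := by ring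
    _ ≤ (∫⁻ x, f x ^ 2 ∂μ) ^ 2 := by gcongr
    _ ≤ _ := h2

theorem tendsto_update_cocompact (i : Fin 3) (x : Pt) :
    Tendsto (Function.update x i) atBot (cocompact Pt) := by
  rw [← Metric.cobounded_eq_cocompact, ← tendsto_norm_atTop_iff_cobounded]
  refine tendsto_atTop_mono (fun t => ?_) tendsto_abs_atBot_atTop
  simpa using norm_le_pi_norm (Function.update x i t) i

theorem hasDerivAt_comp_update {f : Pt → ℝ} (hf : Differentiable ℝ f) (i : Fin 3) (x : Pt) (t : ℝ) :
    HasDerivAt (fun s => f (Function.update x i s)) (pd i f (Function.update x i t)) t := by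
  exact (hf (Function.update x i t)).hasFDerivAt.comp_hasDerivAt t (hasDerivAt_update x i t)

theorem enorm_le_lintegral_update {f : Pt → ℝ} (hf : IsSchwartz f) (i : Fin 3)
    (x : Pt) : ‖f x‖ₑ ≤ ∫⁻ t, ‖pd i f (Function.update x i t)‖ₑ := by
  by_cases hfin : ∫⁻ t, ‖pd i f (Function.update x i t)‖ₑ = ∞
  · simp [hfin]
  have hfi : Integrable fun t => pd i f (Function.update x i t) := by
    refine ⟨?_, lt_top_iff_ne_top.2 hfin⟩
    exact ((hf.pd i).continuous.comp (continuous_const.update i continuous_id)).aestronglyMeasurable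
  have hlim : Tendsto (fun t => f (Function.update x i t)) atBot (nhds 0) := by
    obtain ⟨φ, hφ⟩ := hf.exists_map
    rw [← hφ]
    exact φ.tendsto_cocompact.comp (tendsto_update_cocompact i x)
  have h := integral_Iic_of_hasDerivAt_of_tendsto' (a := x i)
    (fun t _ => hasDerivAt_comp_update hf.differentiable i x t) hfi.integrableOn hlim
  simp only [Function.update_eq_self, sub_zero] at h
  rw [← h]
  exact (enorm_integral_le_lintegral_enorm _).trans (setLIntegral_le_lintegral _ _)

theorem lintegral_pow_three_halves_le {u F : Pt → ℝ≥0∞} (hF : Measurable F)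
    (h : ∀ i x, u x ≤ ∫⁻ t, F (Function.update x i t)) :
    ∫⁻ x, u x ^ (3 / 2 : ℝ) ≤ (∫⁻ x, F x) ^ (3 / 2 : ℝ) := by
  have := lintegral_mul_prod_lintegral_pow_le (fun _ : Fin 3 => (volume : Measure ℝ))
    (p := 1 / 2) (by norm_num) (by norm_num) hF
  norm_num at this
  refine le_trans (lintegral_mono fun x => ?_) this
  calc u x ^ (3 / 2 : ℝ) = ∏ _i : Fin 3, u x ^ (1 / 2 : ℝ) := by
        rw [Finset.prod_const, ← ENNReal.rpow_natCast, ← ENNReal.rpow_mul]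
        norm_num
    _ ≤ _ := Finset.prod_le_prod' fun i _ => by
        gcongr
        exact h i x

theorem lintegral_sq_le_of_lines {u F : (Fin 2 → ℝ) → ℝ≥0∞} (hF : Measurable F)
    (h : ∀ i x, u x ≤ ∫⁻ t, F (Function.update x i t)) :
    ∫⁻ x, u x ^ 2 ≤ (∫⁻ x, F x) ^ 2 := by
  have := lintegral_mul_prod_lintegral_pow_le (fun _ : Fin 2 => (volume : Measure ℝ))
    (p := 1) (by norm_num) (by norm_num) hF
  norm_num [-Fin.prod_univ_two] at this
  refine le_trans (lintegral_mono fun x => ?_) this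
  calc u x ^ 2 = ∏ _i : Fin 2, u x := by simp
    _ ≤ _ := Finset.prod_le_prod' fun i _ => h i x

theorem IsSchwartz.lintegral_ne_top {f : Pt → ℝ} (hf : IsSchwartz f) : ∫⁻ x, ‖f x‖ₑ ≠ ∞ :=
  hf.integrable.2.ne

theorem IsSchwartz.measurable_enorm {f : Pt → ℝ} (hf : IsSchwartz f) :
    Measurable fun x => ‖f x‖ₑ := hf.continuous.measurable.enorm

theorem enorm_pd_pow_four {f : Pt → ℝ} (hf : IsSchwartz f) (i : Fin 3) (x : Pt) :
    ‖pd i (fun y => f y ^ 4) x‖ₑ = 4 * (‖f x ^ 3‖ₑ * ‖pd i f x‖ₑ) := by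
  rw [pd_pow i 4 hf]
  simp only [enorm_mul, mul_assoc]
  congr 1
  simp [enorm_eq_nnnorm]

theorem enorm_pd_sq {f : Pt → ℝ} (hf : IsSchwartz f) (i : Fin 3) (x : Pt) :
    ‖pd i (fun y => f y ^ 2) x‖ₑ = 2 * (‖f x‖ₑ * ‖pd i f x‖ₑ) := by
  rw [pd_pow i 2 hf]
  simp only [enorm_mul, mul_assoc]
  congr 1
  · simp [enorm_eq_nnnorm]
  · simp

/-- The homogeneous Sobolev inequality `‖f‖_{L⁶} ≲ ‖∇f‖_{L²}`. -/
theorem lintegral_pow_six_le {f : Pt → ℝ} (hf : IsSchwartz f) {p : ℝ≥0}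
    (hp : ∀ i, ∫⁻ x, ‖pd i f x‖ₑ ^ 2 ≤ (p : ℝ≥0∞) ^ 2) :
    ∫⁻ x, ‖f x‖ₑ ^ 6 ≤ 144 ^ 3 * (p : ℝ≥0∞) ^ 6 := by
  set S := ∫⁻ x, ‖f x‖ₑ ^ 6 with hS
  have hSfin : S ≠ ∞ := by
    have := (hf.pow 5).lintegral_ne_top
    simpa only [enorm_pow] using this
  have hF : Measurable fun x => ∑ i, ‖pd i (fun y => f y ^ 4) x‖ₑ :=
    Finset.measurable_sum _ fun i _ => ((hf.pow 3).pd i).measurable_enorm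
  have h1 := lintegral_pow_three_halves_le (u := fun x => ‖f x ^ 4‖ₑ) hF fun i x =>
    (enorm_le_lintegral_update (hf.pow 3) i x).trans (lintegral_mono fun t =>
      Finset.single_le_sum (f := fun i => ‖pd i (fun y => f y ^ 4) (Function.update x _ t)‖ₑ)
        (fun _ _ => zero_le) (Finset.mem_univ i))
  set W := ∫⁻ x, ∑ i, ‖pd i (fun y => f y ^ 4) x‖ₑ with hW
  have h2 : ∫⁻ x, ‖f x ^ 4‖ₑ ^ (3 / 2 : ℝ) = S := by
    refine lintegral_congr fun x => ?_
    rw [enorm_pow, ← ENNReal.rpow_natCast, ← ENNReal.rpow_mul, ← ENNReal.rpow_natCast]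
    norm_num
  rw [h2] at h1
  have h3 : S ^ 2 ≤ W ^ 3 := by
    calc S ^ 2 ≤ (W ^ (3 / 2 : ℝ)) ^ 2 := by gcongr
      _ = W ^ 3 := by
        rw [← ENNReal.rpow_natCast, ← ENNReal.rpow_natCast, ← ENNReal.rpow_mul]
        norm_num
  have h4 : ∀ i, (∫⁻ x, ‖pd i (fun y => f y ^ 4) x‖ₑ) ≤ 4 * ∫⁻ x, ‖f x ^ 3‖ₑ * ‖pd i f x‖ₑ := by
    intro i
    rw [← lintegral_const_mul' _ _ (by norm_num)]
    exact le_of_eq (lintegral_congr fun x => enorm_pd_pow_four hf i x)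
  have h5 : ∀ i, (∫⁻ x, ‖f x ^ 3‖ₑ * ‖pd i f x‖ₑ) ^ 2 ≤ S * (p : ℝ≥0∞) ^ 2 := by
    intro i
    refine (sq_lintegral_mul_le (hf.pow 2).measurable_enorm (hf.pd i).measurable_enorm).trans ?_
    refine mul_le_mul' (le_of_eq (lintegral_congr fun x => ?_)) (hp i)
    rw [enorm_pow, ← pow_mul]
  have h6 : ∀ i, (∫⁻ x, ‖f x ^ 3‖ₑ * ‖pd i f x‖ₑ) ≤ S ^ (1 / 2 : ℝ) * p := by
    intro i
    have := ENNReal.rpow_le_rpow (h5 i) (z := 1 / 2) (by norm_num)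
    rw [ENNReal.mul_rpow_of_nonneg _ _ (by norm_num), ← ENNReal.rpow_natCast,
      ← ENNReal.rpow_natCast, ← ENNReal.rpow_mul, ← ENNReal.rpow_mul] at this
    simpa using this
  have h7 : W ≤ 12 * (S ^ (1 / 2 : ℝ) * p) := by
    rw [hW, lintegral_finsetSum _ fun i _ => ((hf.pow 3).pd i).measurable_enorm]
    calc ∑ i, ∫⁻ x, ‖pd i (fun y => f y ^ 4) x‖ₑ
        ≤ ∑ _i : Fin 3, 4 * (S ^ (1 / 2 : ℝ) * p) :=
          Finset.sum_le_sum fun i _ => (h4 i).trans (by gcongr; exact h6 i)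
      _ = _ := by
          rw [Finset.sum_const]
          simp only [Finset.card_univ, Fintype.card_fin, nsmul_eq_mul, ← mul_assoc]
          norm_num
  have h8 : S ^ 3 * S ≤ S ^ 3 * (144 ^ 3 * (p : ℝ≥0∞) ^ 6) := by
    calc S ^ 3 * S = (S ^ 2) ^ 2 := by ring
      _ ≤ (W ^ 3) ^ 2 := by gcongr
      _ ≤ ((12 * (S ^ (1 / 2 : ℝ) * p)) ^ 3) ^ 2 := by gcongr
      _ = ((S ^ (1 / 2 : ℝ)) ^ 2) ^ 3 * ((12 ^ 2) ^ 3 * (p : ℝ≥0∞) ^ 6) := by ring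
      _ = _ := by
        have hS2 : (S ^ (1 / 2 : ℝ)) ^ 2 = S := by
          rw [← ENNReal.rpow_natCast, ← ENNReal.rpow_mul]
          norm_num
        rw [hS2]
        norm_num
  rcases eq_or_ne S 0 with h0 | h0
  · simp [h0]
  · exact (ENNReal.mul_le_mul_iff_right (pow_ne_zero _ h0) (ENNReal.pow_ne_top hSfin)).1 h8

theorem ennreal_add_pow_le (a b : ℝ≥0∞) (n : ℕ) :
    (a + b) ^ (n + 1) ≤ 2 ^ n * (a ^ (n + 1) + b ^ (n + 1)) := by
  induction a with
  | top => simp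
  | coe a =>
    induction b with
    | top => simp
    | coe b => exact_mod_cast add_pow_le (zero_le (a := a)) (zero_le (a := b)) (n + 1)

/-- The point of `ℝ³` with horizontal coordinates `y` and vertical coordinate `z`. -/
def slice (z : ℝ) (y : Fin 2 → ℝ) : Pt := Fin.insertNth (α := fun _ => ℝ) (2 : Fin 3) z y

theorem slice_eq (z : ℝ) (y : Fin 2 → ℝ) : slice z y = ![y 0, y 1, z] := by
  funext i
  fin_cases i <;> rfl

theorem update_slice_two (z t : ℝ) (y : Fin 2 → ℝ) :
    Function.update (slice z y) 2 t = slice t y := by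
  simp only [slice_eq]
  funext i
  fin_cases i <;> rfl

theorem update_slice (z t : ℝ) (y : Fin 2 → ℝ) (i : Fin 2) :
    Function.update (slice z y) i.castSucc t = slice z (Function.update y i t) := by
  simp only [slice_eq]
  funext j
  fin_cases i <;> fin_cases j <;> rfl

theorem slice_self (x : Pt) : slice (x 2) ![x 0, x 1] = x := by
  rw [slice_eq]
  funext i
  fin_cases i <;> rfl

theorem continuous_slice : Continuous fun p : ℝ × (Fin 2 → ℝ) => slice p.1 p.2 := by
  simp only [slice_eq]
  refine continuous_pi fun i => ?_
  fin_cases i <;> simp <;> fun_prop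

theorem lintegral_eq_lintegral_slice {g : Pt → ℝ≥0∞} (hg : Measurable g) :
    ∫⁻ x, g x = ∫⁻ y, ∫⁻ z, g (slice z y) := by
  have h := (volume_preserving_piFinSuccAbove (fun _ : Fin 3 => ℝ) 2).symm
  rw [← h.lintegral_comp hg]
  exact lintegral_prod_symm _ (hg.comp h.measurable).aemeasurable

theorem lintegral_eq_lintegral_slice' {g : Pt → ℝ≥0∞} (hg : Measurable g) :
    ∫⁻ x, g x = ∫⁻ z, ∫⁻ y, g (slice z y) := by
  have h := (volume_preserving_piFinSuccAbove (fun _ : Fin 3 => ℝ) 2).symm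
  rw [← h.lintegral_comp hg]
  exact lintegral_prod _ (hg.comp h.measurable).aemeasurable

theorem lintegral_slice_le {U : Pt → ℝ} (hU : IsSchwartz U) (z : ℝ) :
    ∫⁻ y, ‖U (slice z y)‖ₑ ≤ ∫⁻ x, ‖pd 2 U x‖ₑ := by
  rw [lintegral_eq_lintegral_slice (hU.pd 2).measurable_enorm]
  refine lintegral_mono fun y => ?_
  simpa only [update_slice_two] using enorm_le_lintegral_update hU 2 (slice z y)

theorem lintegral_sq_slice_le {f : Pt → ℝ} (hf : IsSchwartz f) (z : ℝ) {p q : ℝ≥0}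
    (hp : ∫⁻ x, ‖f x‖ₑ ^ 2 ≤ (p : ℝ≥0∞) ^ 2) (hq : ∫⁻ x, ‖pd 2 f x‖ₑ ^ 2 ≤ (q : ℝ≥0∞) ^ 2) :
    ∫⁻ y, ‖f (slice z y)‖ₑ ^ 2 ≤ 2 * (p * q) := by
  have h1 := lintegral_slice_le (hf.pow 1) z
  simp only [enorm_pow, enorm_pd_sq hf] at h1
  refine h1.trans ?_
  rw [lintegral_const_mul' _ _ (by norm_num)]
  gcongr
  have h2 := sq_lintegral_mul_le (μ := volume) hf.measurable_enorm (hf.pd 2).measurable_enorm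
  refine (ENNReal.pow_le_pow_left_iff two_ne_zero).1 (h2.trans ?_)
  rw [mul_pow]
  gcongr

/-- Anisotropic `L⁴` inequality. -/
theorem lintegral_pow_four_le {f : Pt → ℝ} (hf : IsSchwartz f) {p q r : ℝ≥0}
    (hp : ∫⁻ x, ‖f x‖ₑ ^ 2 ≤ (p : ℝ≥0∞) ^ 2) (hq : ∫⁻ x, ‖pd 2 f x‖ₑ ^ 2 ≤ (q : ℝ≥0∞) ^ 2)
    (hr : ∀ i : Fin 2, ∫⁻ x, ‖pd i.castSucc f x‖ₑ ^ 2 ≤ (r : ℝ≥0∞) ^ 2) :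
    ∫⁻ x, ‖f x‖ₑ ^ 4 ≤ 32 * (p * q) * r ^ 2 := by
  set m : (Fin 2 → ℝ) → ℝ → ℝ≥0∞ := fun y z =>
    ∑ i : Fin 2, ‖pd i.castSucc f (slice z y)‖ₑ ^ 2 with hm
  have hmeas : Measurable fun x => ∑ i : Fin 2, ‖pd i.castSucc f x‖ₑ ^ 2 :=
    Finset.measurable_sum _ fun i _ => (hf.pd _).measurable_enorm.pow_const 2
  have hsl : ∀ z, Measurable fun y : Fin 2 → ℝ => slice z y := fun z =>
    (continuous_slice.comp (by fun_prop : Continuous fun y : Fin 2 → ℝ => (z, y))).measurable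
  have key : ∀ z, ∫⁻ y, ‖f (slice z y)‖ₑ ^ 4 ≤ 16 * (p * q) * ∫⁻ y, m y z := by
    intro z
    have h1 := lintegral_sq_le_of_lines
      (u := fun y => ‖f (slice z y)‖ₑ ^ 2)
      (F := fun y => 2 * (‖f (slice z y)‖ₑ * (∑ i : Fin 2, ‖pd i.castSucc f (slice z y)‖ₑ)))
      (((hf.measurable_enorm.comp (hsl z)).mul (Finset.measurable_sum _ fun i _ =>
        (hf.pd _).measurable_enorm.comp (hsl z))).const_mul 2) ?_
    · simp only [← pow_mul] at h1
      refine h1.trans ?_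
      rw [lintegral_const_mul' _ _ (by norm_num), mul_pow]
      have h2 := sq_lintegral_mul_le (μ := volume) (hf.measurable_enorm.comp (hsl z))
        (Finset.measurable_sum (f := fun (i : Fin 2) y => ‖pd i.castSucc f (slice z y)‖ₑ)
          Finset.univ fun i _ => (hf.pd _).measurable_enorm.comp (hsl z))
      have h3 : ∫⁻ y, (∑ i : Fin 2, ‖pd i.castSucc f (slice z y)‖ₑ) ^ 2 ≤ 2 * ∫⁻ y, m y z := by
        rw [← lintegral_const_mul' _ _ (by norm_num)]
        refine lintegral_mono fun y => ?_
        simp only [hm, Fin.sum_univ_two]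
        exact ennreal_add_pow_le _ _ 1 |>.trans (by simp)
      simp only [Function.comp_def] at h2
      calc _ ≤ (2 : ℝ≥0∞) ^ 2 * ((2 * (p * q)) * (2 * ∫⁻ y, m y z)) := by
            gcongr
            exact h2.trans (mul_le_mul' (lintegral_sq_slice_le hf z hp hq) h3)
        _ = _ := by ring
    · intro i y
      have := enorm_le_lintegral_update (hf.pow 1) i.castSucc (slice z y)
      simp only [update_slice, enorm_pow, enorm_pd_sq hf] at this
      refine this.trans (lintegral_mono fun t => ?_)
      gcongr
      exact Finset.single_le_sum
        (f := fun i : Fin 2 => ‖pd i.castSucc f (slice z (Function.update y _ t))‖ₑ)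
        (fun _ _ => zero_le) (Finset.mem_univ i)
  rw [lintegral_eq_lintegral_slice' (hf.measurable_enorm.pow_const 4)]
  calc _ ≤ ∫⁻ z, 16 * (p * q) * ∫⁻ y, m y z := lintegral_mono key
    _ = 16 * (p * q) * ∫⁻ x, ∑ i : Fin 2, ‖pd i.castSucc f x‖ₑ ^ 2 := by
      rw [lintegral_const_mul' _ _ (by finiteness), lintegral_eq_lintegral_slice' hmeas]
    _ ≤ 16 * (p * q) * ∑ _i : Fin 2, (r : ℝ≥0∞) ^ 2 := by
      rw [lintegral_finsetSum _ fun i _ => (hf.pd _).measurable_enorm.pow_const 2]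
      gcongr with i
      exact hr i
    _ = _ := by
      simp only [Fin.sum_univ_two]
      ring

theorem ofReal_mul_lintegral_unit_square_le {g : (Fin 2 → ℝ) → ℝ≥0∞} (hg : Measurable g)
    (y₀ : Fin 2 → ℝ) {u : ℝ} (hu : 0 < u) {m : ℝ≥0}
    (h : ∫⁻ y, g y ^ 4 ≤ (m : ℝ≥0∞) ^ 4) :
    ENNReal.ofReal u * ∫⁻ y in Icc 0 1, g (y₀ + u ^ 2 • y) ≤ m := by
  have hQ : IsProbabilityMeasure ((volume : Measure (Fin 2 → ℝ)).restrict (Icc 0 1)) :=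
    ⟨by simp [Real.volume_Icc_pi]⟩
  refine (ENNReal.pow_le_pow_left_iff (n := 4) (by norm_num)).1 ?_
  have hsc : ∫⁻ y, g (y₀ + u ^ 2 • y) ^ 4 = ENNReal.ofReal (u ^ 4)⁻¹ * ∫⁻ y, g y ^ 4 := by
    have h1 : ∫⁻ y, g (y₀ + u ^ 2 • y) ^ 4 =
        ∫⁻ y, g (y₀ + y) ^ 4 ∂(volume.map fun y : Fin 2 → ℝ => u ^ 2 • y) := by
      rw [lintegral_map (by fun_prop) (by fun_prop)]
    rw [h1, Measure.map_addHaar_smul _ (by positivity), lintegral_smul_measure,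
      lintegral_add_left_eq_self (fun y => g y ^ 4) y₀]
    simp only [Module.finrank_fin_fun, smul_eq_mul, ← pow_mul]
    rw [abs_of_nonneg (by positivity)]
  calc _ = ENNReal.ofReal (u ^ 4) * (∫⁻ y in Icc 0 1, g (y₀ + u ^ 2 • y)) ^ 4 := by
        rw [mul_pow, ENNReal.ofReal_pow hu.le]
    _ ≤ ENNReal.ofReal (u ^ 4) * ∫⁻ y in Icc 0 1, g (y₀ + u ^ 2 • y) ^ 4 := by
        gcongr
        exact lintegral_pow_four_le_of_isProbability (by fun_prop)
    _ ≤ ENNReal.ofReal (u ^ 4) * ∫⁻ y, g (y₀ + u ^ 2 • y) ^ 4 := by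
        gcongr
        exact Measure.restrict_le_self
    _ ≤ ENNReal.ofReal (u ^ 4) * (ENNReal.ofReal (u ^ 4)⁻¹ * (m : ℝ≥0∞) ^ 4) := by
        rw [hsc]
        gcongr
    _ = _ := by
        rw [← mul_assoc, ← ENNReal.ofReal_mul (by positivity), mul_inv_cancel₀ (by positivity)]
        simp

theorem slice_add_smul (z c : ℝ) (y₀ y : Fin 2 → ℝ) :
    slice z (y₀ + c • y) = slice z y₀ + c • slice 0 y := by
  simp only [slice_eq]
  funext i
  fin_cases i <;> simp

theorem slice_zero_eq_sum (y : Fin 2 → ℝ) :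
    slice 0 y = ∑ i : Fin 2, y i • (Pi.single i.castSucc 1 : Pt) := by
  simp only [slice_eq, Fin.sum_univ_two]
  funext i
  fin_cases i <;> simp

theorem hasDerivAt_slice_path {f : Pt → ℝ} (hf : IsSchwartz f) (z : ℝ) (y₀ y : Fin 2 → ℝ)
    (u : ℝ) : HasDerivAt (fun u => f (slice z (y₀ + u ^ 2 • y)))
      (2 * u * ∑ i : Fin 2, y i * pd i.castSucc f (slice z (y₀ + u ^ 2 • y))) u := by
  simp only [slice_add_smul]
  have h1 : HasDerivAt (fun u : ℝ => slice z y₀ + u ^ 2 • slice 0 y) ((2 * u) • slice 0 y) u := by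
    simpa using ((hasDerivAt_pow 2 u).smul_const (slice 0 y)).const_add (slice z y₀)
  convert! (hf.differentiable _).hasFDerivAt.comp_hasDerivAt u h1 using 1
  rw [map_smul, slice_zero_eq_sum, map_sum]
  simp [pd]

theorem enorm_slice_le_path {f : Pt → ℝ} (hf : IsSchwartz f) (z : ℝ) (y₀ : Fin 2 → ℝ)
    {y : Fin 2 → ℝ} (hy : y ∈ Icc (0 : Fin 2 → ℝ) 1) {r : ℝ} (hr : 0 < r) :
    ‖f (slice z y₀)‖ₑ ≤ ‖f (slice z (y₀ + r ^ 2 • y))‖ₑ + ∫⁻ u in Ioc 0 r,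
      2 * ENNReal.ofReal u * ∑ i : Fin 2, ‖pd i.castSucc f (slice z (y₀ + u ^ 2 • y))‖ₑ := by
  have hc : ∀ i : Fin 2, Continuous fun u : ℝ => pd i.castSucc f (slice z (y₀ + u ^ 2 • y)) :=
    fun i => (hf.pd _).continuous.comp (continuous_slice.comp
      (by fun_prop : Continuous fun u : ℝ => (z, y₀ + u ^ 2 • y)))
  have h := intervalIntegral.integral_eq_sub_of_hasDerivAt (a := 0) (b := r)
    (fun u _ => hasDerivAt_slice_path hf z y₀ y u)
    (Continuous.intervalIntegrable (by fun_prop) _ _)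
  simp only [ne_eq, OfNat.ofNat_ne_zero, not_false_eq_true, zero_pow, zero_smul, add_zero] at h
  rw [intervalIntegral.integral_of_le hr.le] at h
  have h2 : f (slice z y₀) = f (slice z (y₀ + r ^ 2 • y)) - ∫ u in Ioc 0 r,
      2 * u * ∑ i : Fin 2, y i * pd i.castSucc f (slice z (y₀ + u ^ 2 • y)) := by
    rw [h]
    ring
  rw [h2]
  refine enorm_sub_le.trans ?_
  gcongr
  refine (enorm_integral_le_lintegral_enorm _).trans ?_
  refine setLIntegral_mono' measurableSet_Ioc fun u hu => ?_
  rw [enorm_mul, enorm_mul]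
  refine mul_le_mul' (le_of_eq ?_) ((enorm_sum_le _ _).trans (Finset.sum_le_sum fun i _ => ?_))
  · rw [Real.enorm_of_nonneg hu.1.le]
    simp [enorm_eq_nnnorm]
  · rw [enorm_mul]
    have : ‖y i‖ₑ ≤ 1 := by
      rw [Real.enorm_of_nonneg (hy.1 i)]
      simpa using hy.2 i
    simpa using mul_le_mul' this le_rfl

theorem measurable_slice (z : ℝ) : Measurable fun y : Fin 2 → ℝ => slice z y :=
  (continuous_slice.comp (by fun_prop : Continuous fun y : Fin 2 → ℝ => (z, y))).measurable

theorem measurable_enorm_slice_path {f : Pt → ℝ} (hf : IsSchwartz f) (z : ℝ)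
    (y₀ : Fin 2 → ℝ) : Measurable fun p : (Fin 2 → ℝ) × ℝ =>
      ‖f (slice z (y₀ + p.2 ^ 2 • p.1))‖ₑ :=
  (hf.continuous.comp (continuous_slice.comp (by fun_prop :
      Continuous fun p : (Fin 2 → ℝ) × ℝ => (z, y₀ + p.2 ^ 2 • p.1)))).measurable.enorm

theorem measurable_enorm_slice_smul {f : Pt → ℝ} (hf : IsSchwartz f) (z : ℝ)
    (y₀ : Fin 2 → ℝ) (u : ℝ) : Measurable fun y : Fin 2 → ℝ =>
      ‖f (slice z (y₀ + u ^ 2 • y))‖ₑ :=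
  (hf.continuous.comp (continuous_slice.comp (by fun_prop :
      Continuous fun y : Fin 2 → ℝ => (z, y₀ + u ^ 2 • y)))).measurable.enorm

theorem isProbabilityMeasure_unit_square :
    IsProbabilityMeasure ((volume : Measure (Fin 2 → ℝ)).restrict (Icc 0 1)) :=
  ⟨by simp [Real.volume_Icc_pi]⟩

theorem enorm_slice_le_average {f : Pt → ℝ} (hf : IsSchwartz f) (z : ℝ) (y₀ : Fin 2 → ℝ)
    {r : ℝ} (hr : 0 < r) :
    ‖f (slice z y₀)‖ₑ ≤ (∫⁻ y in Icc 0 1, ‖f (slice z (y₀ + r ^ 2 • y))‖ₑ) +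
      ∫⁻ y in Icc 0 1, ∫⁻ u in Ioc 0 r, 2 * ENNReal.ofReal u *
        ∑ i : Fin 2, ‖pd i.castSucc f (slice z (y₀ + u ^ 2 • y))‖ₑ := by
  have hQ := isProbabilityMeasure_unit_square
  rw [← lintegral_add_left (measurable_enorm_slice_smul hf z y₀ r)]
  calc ‖f (slice z y₀)‖ₑ = ∫⁻ _y in Icc (0 : Fin 2 → ℝ) 1, ‖f (slice z y₀)‖ₑ := by
        rw [lintegral_const, measure_univ, mul_one]
    _ ≤ _ := setLIntegral_mono' measurableSet_Icc fun y hy => enorm_slice_le_path hf z y₀ hy hr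

theorem lintegral_average_le {f : Pt → ℝ} (hf : IsSchwartz f) (z : ℝ) (y₀ : Fin 2 → ℝ)
    {k : ℝ≥0} (hk : ∀ i : Fin 2, ∫⁻ y, ‖pd i.castSucc f (slice z y)‖ₑ ^ 4 ≤ (k : ℝ≥0∞) ^ 4)
    (r : ℝ) :
    ∫⁻ y in Icc 0 1, ∫⁻ u in Ioc 0 r, 2 * ENNReal.ofReal u *
      ∑ i : Fin 2, ‖pd i.castSucc f (slice z (y₀ + u ^ 2 • y))‖ₑ ≤ 4 * k * ENNReal.ofReal r := by
  have hc := fun i : Fin 2 => measurable_enorm_slice_path (hf.pd i.castSucc) z y₀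
  have hmeas : Measurable fun p : (Fin 2 → ℝ) × ℝ => 2 * ENNReal.ofReal p.2 *
      ∑ i : Fin 2, ‖pd i.castSucc f (slice z (y₀ + p.2 ^ 2 • p.1))‖ₑ :=
    (by fun_prop : Measurable fun p : (Fin 2 → ℝ) × ℝ => 2 * ENNReal.ofReal p.2).mul
      (Finset.measurable_sum _ fun i _ => hc i)
  rw [lintegral_lintegral_swap hmeas.aemeasurable]
  calc _ ≤ ∫⁻ u in Ioc 0 r, 4 * (k : ℝ≥0∞) := by
        refine setLIntegral_mono' measurableSet_Ioc fun u hu => ?_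
        have h3 : ∀ i : Fin 2, ENNReal.ofReal u *
            ∫⁻ y in Icc 0 1, ‖pd i.castSucc f (slice z (y₀ + u ^ 2 • y))‖ₑ ≤ k := fun i =>
          ofReal_mul_lintegral_unit_square_le
            ((hf.pd _).measurable_enorm.comp (measurable_slice z)) y₀ hu.1 (hk i)
        rw [lintegral_const_mul' _ _ (by finiteness), lintegral_finsetSum _ fun i _ =>
          measurable_enorm_slice_smul (hf.pd _) z y₀ u, Fin.sum_univ_two, mul_assoc, mul_add]
        calc _ ≤ 2 * ((k : ℝ≥0∞) + k) := by
              gcongr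
              exacts [h3 0, h3 1]
          _ = _ := by ring
    _ = _ := by rw [setLIntegral_const, Real.volume_Ioc, sub_zero]

/-- A two-dimensional Morrey inequality on horizontal slices. -/
theorem enorm_slice_mul_le {f : Pt → ℝ} (hf : IsSchwartz f) (z : ℝ) (y₀ : Fin 2 → ℝ)
    {m k : ℝ≥0} (hm : ∫⁻ y, ‖f (slice z y)‖ₑ ^ 4 ≤ (m : ℝ≥0∞) ^ 4)
    (hk : ∀ i : Fin 2, ∫⁻ y, ‖pd i.castSucc f (slice z y)‖ₑ ^ 4 ≤ (k : ℝ≥0∞) ^ 4)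
    {r : ℝ} (hr : 0 < r) :
    ‖f (slice z y₀)‖ₑ * ENNReal.ofReal r ≤ m + 4 * k * ENNReal.ofReal r ^ 2 := by
  have h1 := (enorm_slice_le_average hf z y₀ hr).trans
    (add_le_add_right (lintegral_average_le hf z y₀ hk r) _)
  have h4 := ofReal_mul_lintegral_unit_square_le
    (hf.measurable_enorm.comp (measurable_slice z)) y₀ hr hm
  simp only [Function.comp_def] at h4
  calc _ ≤ ((∫⁻ y in Icc 0 1, ‖f (slice z (y₀ + r ^ 2 • y))‖ₑ) + 4 * k * ENNReal.ofReal r) *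
        ENNReal.ofReal r := mul_le_mul' h1 le_rfl
    _ = ENNReal.ofReal r * (∫⁻ y in Icc 0 1, ‖f (slice z (y₀ + r ^ 2 • y))‖ₑ) +
        4 * k * ENNReal.ofReal r ^ 2 := by ring
    _ ≤ _ := add_le_add_left h4 _

theorem lintegral_slice_pow_four_le {f : Pt → ℝ} (hf : IsSchwartz f) {p : ℝ≥0}
    (hp : ∀ i, ∫⁻ x, ‖pd i f x‖ₑ ^ 2 ≤ (p : ℝ≥0∞) ^ 2) (z : ℝ) :
    ∫⁻ y, ‖f (slice z y)‖ₑ ^ 4 ≤ ((10 * p : ℝ≥0) : ℝ≥0∞) ^ 4 := by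
  have h1 := lintegral_slice_le (hf.pow 3) z
  simp only [enorm_pow, enorm_pd_pow_four hf] at h1
  rw [lintegral_const_mul' _ _ (by norm_num)] at h1
  have h2 := sq_lintegral_mul_le (μ := volume) (hf.measurable_enorm.pow_const 3)
    (hf.pd 2).measurable_enorm
  simp only [← pow_mul] at h2
  have h3 : ∫⁻ x, ‖f x‖ₑ ^ 3 * ‖pd 2 f x‖ₑ ≤ 1728 * (p : ℝ≥0∞) ^ 4 := by
    refine (ENNReal.pow_le_pow_left_iff two_ne_zero).1 (h2.trans ?_)
    calc _ ≤ 144 ^ 3 * (p : ℝ≥0∞) ^ 6 * (p : ℝ≥0∞) ^ 2 :=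
          mul_le_mul' (lintegral_pow_six_le hf hp) (hp 2)
      _ = _ := by ring
  refine h1.trans ?_
  calc _ ≤ 4 * (1728 * (p : ℝ≥0∞) ^ 4) := by gcongr
    _ = 6912 * (p : ℝ≥0∞) ^ 4 := by ring
    _ ≤ 10 ^ 4 * (p : ℝ≥0∞) ^ 4 := by
        gcongr
        norm_num
    _ = _ := by
        push_cast
        ring

/-- Anisotropic `L^∞` inequality. -/
theorem sq_le_of_lintegral {f : Pt → ℝ} (hf : IsSchwartz f) {p q : ℝ≥0}
    (hp : ∀ i, ∫⁻ x, ‖pd i f x‖ₑ ^ 2 ≤ (p : ℝ≥0∞) ^ 2)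
    (hq : ∀ i, ∀ j : Fin 2, ∫⁻ x, ‖pd i (pd j.castSucc f) x‖ₑ ^ 2 ≤ (q : ℝ≥0∞) ^ 2) (x : Pt) :
    f x ^ 2 ≤ 1600 * (p * q) := by
  have key : ∀ r : ℝ, 0 ≤ 40 * (q : ℝ) * (r * r) + -|f x| * r + 10 * p := by
    intro r
    rcases le_or_gt r 0 with hr | hr
    · have := mul_nonneg (abs_nonneg (f x)) (neg_nonneg.2 hr)
      have : 0 ≤ 40 * (q : ℝ) * (r * r) := mul_nonneg (by positivity) (mul_self_nonneg r)
      have : 0 ≤ 10 * (p : ℝ) := by positivity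
      linarith
    · have h := enorm_slice_mul_le hf (x 2) ![x 0, x 1] (lintegral_slice_pow_four_le hf hp _)
        (fun i => lintegral_slice_pow_four_le (hf.pd _) (fun j => hq j i) _) hr
      rw [slice_self] at h
      have h' := ENNReal.toReal_mono (by finiteness) h
      rw [ENNReal.toReal_add (by finiteness) (by finiteness)] at h'
      simp [ENNReal.toReal_ofReal hr.le] at h'
      linarith
  have := discrim_le_zero key
  rw [discrim, neg_sq, sq_abs] at this
  linarith

/-- `f` is bounded by `M`. -/
def SupLE (f : Pt → ℝ) (M : ℝ) : Prop := ∀ x, |f x| ≤ M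

/-- The `L²` norm of `f` is at most `M`. -/
def L2LE (f : Pt → ℝ) (M : ℝ) : Prop := 0 ≤ M ∧ l2Sq f ≤ M ^ 2

/-- The `L⁴` norm of `f` is at most `M`. -/
def L4LE (f : Pt → ℝ) (M : ℝ) : Prop := 0 ≤ M ∧ ∫ x, f x ^ 4 ≤ M ^ 4

theorem SupLE.nonneg {f : Pt → ℝ} {M : ℝ} (h : SupLE f M) : 0 ≤ M := (abs_nonneg _).trans (h 0)

theorem lintegral_enorm_pow {f : Pt → ℝ} (hf : IsSchwartz f) (n : ℕ) :
    ∫⁻ x, ‖f x‖ₑ ^ (2 * (n + 1)) = ENNReal.ofReal (∫ x, f x ^ (2 * (n + 1))) := by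
  have hfi : Integrable fun x => f x ^ (2 * (n + 1)) := (hf.pow (2 * n + 1)).integrable
  rw [ofReal_integral_eq_lintegral_ofReal hfi
    (ae_of_all _ fun x => (even_two_mul _).pow_nonneg _)]
  refine lintegral_congr fun x => ?_
  rw [← enorm_pow, Real.enorm_of_nonneg ((even_two_mul _).pow_nonneg _)]

theorem L2LE.lintegral_le {f : Pt → ℝ} {M : ℝ} (h : L2LE f M) (hf : IsSchwartz f) :
    ∫⁻ x, ‖f x‖ₑ ^ 2 ≤ (M.toNNReal : ℝ≥0∞) ^ 2 := by
  rw [show ∫⁻ x, ‖f x‖ₑ ^ 2 = _ from lintegral_enorm_pow hf 0, ← ENNReal.ofReal.eq_1,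
    ← ENNReal.ofReal_pow h.1]
  exact ENNReal.ofReal_le_ofReal h.2

theorem l4LE_of_l2LE {f : Pt → ℝ} (hf : IsSchwartz f) {p r m : ℝ} (hm : 0 ≤ m)
    (hmpr : p * r ≤ m ^ 2) (hp : L2LE f p)
    (hq : L2LE (pd 2 f) p) (hr : ∀ i, i ≠ 2 → L2LE (pd i f) r) : L4LE f (3 * m) := by
  refine ⟨by positivity, ?_⟩
  have hr0 := (hr 0 (by decide)).1
  have h := lintegral_pow_four_le hf (hp.lintegral_le hf) (hq.lintegral_le (hf.pd 2))
    (fun i => (hr _ (Fin.castSucc_lt_last i).ne).lintegral_le (hf.pd _))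
  rw [show ∫⁻ x, ‖f x‖ₑ ^ 4 = _ from lintegral_enorm_pow hf 1] at h
  have h' := ENNReal.toReal_mono (by finiteness) h
  rw [ENNReal.toReal_ofReal (integral_nonneg fun x => (even_two_mul 2).pow_nonneg _)] at h'
  simp [hp.1, hr0] at h'
  calc _ ≤ 32 * (p * p) * r ^ 2 := h'
    _ = 32 * (p * r) ^ 2 := by ring
    _ ≤ 32 * (m ^ 2) ^ 2 := by
      have := mul_nonneg hp.1 hr0
      gcongr
    _ ≤ _ := by nlinarith [pow_nonneg hm 4]

theorem supLE_of_l2LE {f : Pt → ℝ} (hf : IsSchwartz f) {p q m : ℝ} (hm : 0 ≤ m)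
    (hmpq : p * q ≤ m ^ 2) (hp : ∀ i, L2LE (pd i f) p)
    (hq : ∀ i j, j ≠ 2 → L2LE (pd i (pd j f)) q) : SupLE f (40 * m) := by
  intro x
  have h := sq_le_of_lintegral hf (fun i => (hp i).lintegral_le (hf.pd i))
    (fun i j => (hq i _ (Fin.castSucc_lt_last j).ne).lintegral_le ((hf.pd _).pd _)) x
  rw [Real.coe_toNNReal _ (hp 0).1, Real.coe_toNNReal _ (hq 0 0 (by decide)).1] at h
  refine abs_le_of_sq_le_sq ?_ (by positivity)
  linarith

theorem sq_integral_mul_le {f g : Pt → ℝ} (hf : IsSchwartz f) (hg : IsSchwartz g) :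
    (∫ x, f x * g x) ^ 2 ≤ l2Sq f * l2Sq g := by
  have key : ∀ t : ℝ, 0 ≤ l2Sq f * (t * t) + (2 * ∫ x, f x * g x) * t + l2Sq g := by
    intro t
    calc 0 ≤ ∫ x, (t * f x + g x) ^ 2 := integral_nonneg fun x => sq_nonneg _
      _ = ∫ x, ((t * t) * f x ^ 2 + (2 * t) * (f x * g x) + g x ^ 2) := by
        congr 1
        funext x
        ring
      _ = _ := by
        have h1 : Integrable fun x => t * t * f x ^ 2 := (hf.pow 1).integrable.const_mul _
        have h2 : Integrable fun x => 2 * t * (f x * g x) := (hf.mul hg).integrable.const_mul _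
        have h3 : Integrable fun x => g x ^ 2 := (hg.pow 1).integrable
        have h4 : Integrable fun x => t * t * f x ^ 2 + 2 * t * (f x * g x) := h1.add h2
        rw [integral_add h4 h3, integral_add h1 h2, integral_const_mul,
          integral_const_mul]
        simp only [l2Sq]
        ring
  have := discrim_le_zero key
  rw [discrim] at this
  linarith

theorem abs_integral_mul_le {f g : Pt → ℝ} {a b : ℝ} (hf : IsSchwartz f) (hg : IsSchwartz g)
    (ha : L2LE f a) (hb : L2LE g b) : |∫ x, f x * g x| ≤ a * b := by
  refine abs_le_of_sq_le_sq ?_ (mul_nonneg ha.1 hb.1)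
  calc _ ≤ l2Sq f * l2Sq g := sq_integral_mul_le hf hg
    _ ≤ a ^ 2 * b ^ 2 := mul_le_mul ha.2 hb.2 (l2Sq_nonneg _) (sq_nonneg _)
    _ = _ := by ring

theorem L2LE.mono {f : Pt → ℝ} {a b : ℝ} (h : L2LE f a) (hab : a ≤ b) : L2LE f b :=
  ⟨h.1.trans hab, h.2.trans (pow_le_pow_left₀ h.1 hab 2)⟩

theorem L4LE.mono {f : Pt → ℝ} {a b : ℝ} (h : L4LE f a) (hab : a ≤ b) : L4LE f b :=
  ⟨h.1.trans hab, h.2.trans (pow_le_pow_left₀ h.1 hab 4)⟩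

theorem SupLE.l2_mul {f g : Pt → ℝ} {a b : ℝ} (ha : SupLE f a) (hb : L2LE g b)
    (hg : IsSchwartz g) : L2LE (fun x => f x * g x) (a * b) := by
  refine ⟨mul_nonneg ha.nonneg hb.1, ?_⟩
  calc l2Sq (fun x => f x * g x) ≤ ∫ x, a ^ 2 * g x ^ 2 := by
        refine integral_mono_of_nonneg (ae_of_all _ fun x => sq_nonneg _)
          ((hg.pow 1).integrable.const_mul _) (ae_of_all _ fun x => ?_)
        simp only [mul_pow]
        exact mul_le_mul_of_nonneg_right (sq_le_sq' (abs_le.1 (ha x)).1 (abs_le.1 (ha x)).2)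
          (sq_nonneg _)
    _ = a ^ 2 * l2Sq g := integral_const_mul _ _
    _ ≤ a ^ 2 * b ^ 2 := by
        gcongr
        exact hb.2
    _ = _ := by ring

theorem SupLE.mul {f g : Pt → ℝ} {a b : ℝ} (ha : SupLE f a) (hb : SupLE g b) :
    SupLE (fun x => f x * g x) (a * b) := fun x => by
  rw [abs_mul]
  exact mul_le_mul (ha x) (hb x) (abs_nonneg _) ha.nonneg

theorem L4LE.l2_mul {f g : Pt → ℝ} {a b : ℝ} (ha : L4LE f a) (hb : L4LE g b)
    (hf : IsSchwartz f) (hg : IsSchwartz g) : L2LE (fun x => f x * g x) (a * b) := by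
  refine ⟨mul_nonneg ha.1 hb.1, ?_⟩
  have h := abs_integral_mul_le (hf.pow 1) (hg.pow 1) (a := a ^ 2) (b := b ^ 2)
    ⟨sq_nonneg _, by simpa only [l2Sq, ← pow_mul] using ha.2⟩
    ⟨sq_nonneg _, by simpa only [l2Sq, ← pow_mul] using hb.2⟩
  simp only [l2Sq, mul_pow]
  exact (le_abs_self _).trans h

/-- Trilinear estimate with one bounded and two square integrable factors. -/
theorem abs_integral_sup_le {f g h : Pt → ℝ} {a b c : ℝ} (hf : IsSchwartz f) (hg : IsSchwartz g)
    (hh : IsSchwartz h) (ha : SupLE f a) (hb : L2LE g b) (hc : L2LE h c) :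
    |∫ x, f x * g x * h x| ≤ a * b * c :=
  abs_integral_mul_le (hf.mul hg) hh (ha.l2_mul hb hg) hc

/-- Trilinear estimate with two `L⁴` factors and one square integrable factor. -/
theorem abs_integral_l4_le {f g h : Pt → ℝ} {a b c : ℝ} (hf : IsSchwartz f) (hg : IsSchwartz g)
    (hh : IsSchwartz h) (ha : L4LE f a) (hb : L4LE g b) (hc : L2LE h c) :
    |∫ x, f x * g x * h x| ≤ a * b * c :=
  abs_integral_mul_le (hf.mul hg) hh (ha.l2_mul hb hf hg) hc

/-! ### Bounds at a fixed time -/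

/-- A list of directions containing a horizontal one. -/
def Horizontal (L : List (Fin 3)) : Prop := ∃ i ∈ L, i ≠ 2

open Classical in
/-- The size of `iterPd L ψ`: `b` for lists with a horizontal direction, `E` otherwise. -/
def psiSize (b E : ℝ) (L : List (Fin 3)) : ℝ := if Horizontal L then b else E

/-- Schwartz fields `v`, `ψ` with `div v = 0` and bounds on their derivatives up to order three. -/
structure FlowBounds (v : Fin 3 → Pt → ℝ) (ψ : Pt → ℝ) (A b E : ℝ) : Prop where
  hv : ∀ j, IsSchwartz (v j)
  hψ : IsSchwartz ψ
  div_free : ∀ x, ∑ i, pd i (v i) x = 0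
  b_le : b ≤ E
  l2_v : ∀ j L, L ≠ [] → L.length ≤ 3 → L2LE (iterPd L (v j)) A
  l2_ψ : ∀ L, L ≠ [] → L.length ≤ 3 → L2LE (iterPd L ψ) E
  l2_ψ_hor : ∀ L, 2 ≤ L.length → L.length ≤ 3 → Horizontal L → L2LE (iterPd L ψ) b

theorem horizontal_cons_of_ne {i : Fin 3} (hi : i ≠ 2) (L : List (Fin 3)) : Horizontal (i :: L) :=
  ⟨i, by simp, hi⟩

theorem Horizontal.cons {L : List (Fin 3)} (h : Horizontal L) (i : Fin 3) :
    Horizontal (i :: L) := by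
  obtain ⟨j, hj, hj2⟩ := h
  exact ⟨j, List.mem_cons_of_mem _ hj, hj2⟩

theorem psiSize_hor {b E : ℝ} {L : List (Fin 3)} (h : Horizontal L) : psiSize b E L = b := if_pos h

namespace FlowBounds

variable {v : Fin 3 → Pt → ℝ} {ψ : Pt → ℝ} {A b E : ℝ}

theorem A_nonneg (H : FlowBounds v ψ A b E) : 0 ≤ A := (H.l2_v 0 [0] (by simp) (by simp)).1

theorem b_nonneg (H : FlowBounds v ψ A b E) : 0 ≤ b :=
  (H.l2_ψ_hor [0, 0] (by simp) (by simp) (horizontal_cons_of_ne (by decide) _)).1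

theorem E_nonneg (H : FlowBounds v ψ A b E) : 0 ≤ E := H.b_nonneg.trans H.b_le

theorem le_psiSize (H : FlowBounds v ψ A b E) (L : List (Fin 3)) : b ≤ psiSize b E L := by
  unfold psiSize
  split_ifs
  exacts [le_rfl, H.b_le]

theorem psiSize_le (H : FlowBounds v ψ A b E) (L : List (Fin 3)) : psiSize b E L ≤ E := by
  unfold psiSize
  split_ifs
  exacts [H.b_le, le_rfl]

theorem psiSize_nonneg (H : FlowBounds v ψ A b E) (L : List (Fin 3)) : 0 ≤ psiSize b E L :=
  H.b_nonneg.trans (H.le_psiSize L)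

theorem l2_psiSize (H : FlowBounds v ψ A b E) {L : List (Fin 3)} (h2 : 2 ≤ L.length)
    (h3 : L.length ≤ 3) : L2LE (iterPd L ψ) (psiSize b E L) := by
  unfold psiSize
  split_ifs with h
  · exact H.l2_ψ_hor L h2 h3 h
  · exact H.l2_ψ L (List.ne_nil_of_length_pos (by omega)) h3

theorem l2_cons_psiSize (H : FlowBounds v ψ A b E) {L : List (Fin 3)} (h1 : 1 ≤ L.length)
    (h2 : L.length ≤ 2) (i : Fin 3) : L2LE (pd i (iterPd L ψ)) (psiSize b E L) := by
  have := H.l2_psiSize (L := i :: L) (by simpa using h1)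
    (by simp; omega)
  refine this.mono ?_
  unfold psiSize
  split_ifs with h h' h'
  exacts [le_rfl, H.b_le, absurd (h'.cons i) h, le_rfl]

theorem sup_v (H : FlowBounds v ψ A b E) (j : Fin 3) {L : List (Fin 3)} (hL : L.length ≤ 1) :
    SupLE (iterPd L (v j)) (40 * A) :=
  supLE_of_l2LE ((H.hv j).iterPd L) H.A_nonneg (sq A).ge
    (fun i => H.l2_v j (i :: L) (by simp) (by simp; omega))
    fun i k _ => H.l2_v j (i :: k :: L) (by simp) (by simp; omega)

theorem l4_v (H : FlowBounds v ψ A b E) (j : Fin 3) {L : List (Fin 3)} (hL : L ≠ [])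
    (hL2 : L.length ≤ 2) : L4LE (iterPd L (v j)) (3 * A) :=
  l4LE_of_l2LE ((H.hv j).iterPd L) H.A_nonneg (sq A).ge (H.l2_v j L hL (by omega))
    (H.l2_v j (2 :: L) (by simp) (by simp; omega))
    fun i _ => H.l2_v j (i :: L) (by simp) (by simp; omega)

theorem sup_ψ (H : FlowBounds v ψ A b E) (i : Fin 3) :
    SupLE (pd i ψ) (40 * psiSize b E [i]) :=
  supLE_of_l2LE (H.hψ.pd i) (H.psiSize_nonneg _) (sq _).ge
    (fun k => H.l2_cons_psiSize (L := [i]) (by simp) (by simp) k)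
    fun k j hj => (H.l2_ψ_hor [k, j, i] (by simp) (by simp)
      ((horizontal_cons_of_ne hj _).cons _)).mono (H.le_psiSize _)

theorem l4_ψ (H : FlowBounds v ψ A b E) {L : List (Fin 3)} (hL : L.length = 2) :
    L4LE (iterPd L ψ) (3 * psiSize b E L) :=
  l4LE_of_l2LE (H.hψ.iterPd L) (H.psiSize_nonneg _) (sq _).ge
    (H.l2_psiSize hL.ge (by omega)) (H.l2_cons_psiSize (by omega) hL.le 2)
    fun i _ => H.l2_cons_psiSize (by omega) hL.le i

/-- Improved bound on the vertical derivative. -/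
theorem sup_vert (H : FlowBounds v ψ A b E) : SupLE (pd 2 ψ) (40 * √(E * b)) :=
  supLE_of_l2LE (H.hψ.pd 2) (Real.sqrt_nonneg _)
    (Real.sq_sqrt (mul_nonneg H.E_nonneg H.b_nonneg)).ge
    (fun k => H.l2_ψ [k, 2] (by simp) (by simp))
    fun k j hj => H.l2_ψ_hor [k, j, 2] (by simp) (by simp) ((horizontal_cons_of_ne hj _).cons _)

theorem l4_vert (H : FlowBounds v ψ A b E) : L4LE (pd 2 (pd 2 ψ)) (3 * √(E * b)) :=
  l4LE_of_l2LE ((H.hψ.pd 2).pd 2) (Real.sqrt_nonneg _)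
    (Real.sq_sqrt (mul_nonneg H.E_nonneg H.b_nonneg)).ge
    (H.l2_ψ [2, 2] (by simp) (by simp)) (H.l2_ψ [2, 2, 2] (by simp) (by simp))
    fun j hj => H.l2_ψ_hor [j, 2, 2] (by simp) (by simp) (horizontal_cons_of_ne hj _)

/-- Trilinear terms in which some derivative of `ψ` is horizontal. -/
theorem abs_integral_le (H : FlowBounds v ψ A b E) (j : Fin 3) {β γ δ : List (Fin 3)}
    (hβ : β ≠ []) (hγ : γ ≠ []) (hlen : β.length + γ.length = δ.length + 1) (hδ : δ.length ≤ 3)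
    (hor : Horizontal γ ∨ Horizontal δ) :
    |∫ x, iterPd β (v j) x * iterPd γ ψ x * iterPd δ ψ x| ≤ 40 * (A * b * E) := by
  have hA := H.A_nonneg
  have hb := H.b_nonneg
  have hE := H.E_nonneg
  have hsβ := (H.hv j).iterPd β
  have hsγ := H.hψ.iterPd γ
  have hsδ := H.hψ.iterPd δ
  have hβ1 := List.length_pos_of_ne_nil hβ
  have hγ1 := List.length_pos_of_ne_nil hγ
  have hδ0 : δ ≠ [] := List.ne_nil_of_length_pos (by omega)
  have hsz : psiSize b E γ * psiSize b E δ ≤ b * E := by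
    rcases hor with h | h
    · rw [psiSize_hor h]
      exact mul_le_mul_of_nonneg_left (H.psiSize_le δ) hb
    · rw [psiSize_hor h, mul_comm]
      exact mul_le_mul_of_nonneg_left (H.psiSize_le γ) hb
  have hfin : A * (psiSize b E γ * psiSize b E δ) ≤ A * (b * E) := mul_le_mul_of_nonneg_left hsz hA
  have hfin0 : 0 ≤ A * (psiSize b E γ * psiSize b E δ) :=
    mul_nonneg hA (mul_nonneg (H.psiSize_nonneg _) (H.psiSize_nonneg _))
  rcases (by omega : (δ.length = 1 ∧ γ.length = 1 ∧ β.length = 1) ∨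
    (2 ≤ δ.length ∧ 2 ≤ γ.length ∧ β.length = 1) ∨
    (2 ≤ δ.length ∧ γ.length = 2 ∧ β.length = 2) ∨ (2 ≤ δ.length ∧ γ.length = 1 ∧ β.length ≤ 3))
    with ⟨h1, h2, h3⟩ | ⟨h1, h2, h3⟩ | ⟨h1, h2, h3⟩ | ⟨h1, h2, h3⟩
  · rcases hor with h | h
    · obtain ⟨i, rfl⟩ := List.length_eq_one_iff.1 h2
      have hs := H.sup_ψ i
      rw [psiSize_hor h] at hs
      have := abs_integral_sup_le hsγ hsβ hsδ hs (H.l2_v j β hβ (by omega))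
        (H.l2_ψ δ hδ0 (by omega))
      calc _ = |∫ x, iterPd [i] ψ x * iterPd β (v j) x * iterPd δ ψ x| := by
            simp only [mul_comm (iterPd [i] ψ _)]
        _ ≤ _ := this
        _ = _ := by ring
    · obtain ⟨i, rfl⟩ := List.length_eq_one_iff.1 h1
      have hs := H.sup_ψ i
      rw [psiSize_hor h] at hs
      have := abs_integral_sup_le hsδ hsβ hsγ hs (H.l2_v j β hβ (by omega))
        (H.l2_ψ γ hγ (by omega))
      calc _ = |∫ x, iterPd [i] ψ x * iterPd β (v j) x * iterPd γ ψ x| := by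
            congr 2
            funext x
            ring
        _ ≤ _ := this
        _ = _ := by ring
  · have := abs_integral_sup_le hsβ hsγ hsδ (H.sup_v j h3.le)
      (H.l2_psiSize h2 (by omega)) (H.l2_psiSize h1 hδ)
    linarith
  · have := abs_integral_l4_le hsβ hsγ hsδ (H.l4_v j hβ h3.le) (H.l4_ψ h2) (H.l2_psiSize h1 hδ)
    linarith
  · obtain ⟨i, rfl⟩ := List.length_eq_one_iff.1 h2
    have := abs_integral_sup_le hsγ hsβ hsδ (H.sup_ψ i) (H.l2_v j β hβ h3) (H.l2_psiSize h1 hδ)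
    calc _ = |∫ x, iterPd [i] ψ x * iterPd β (v j) x * iterPd δ ψ x| := by
          simp only [mul_comm (iterPd [i] ψ _)]
      _ ≤ _ := this
      _ = 40 * (A * (psiSize b E [i] * psiSize b E δ)) := by ring
      _ ≤ _ := by linarith

end FlowBounds

/-! ### Leibniz formula -/

theorem IsSchwartz.list_sum {ι : Type*} (l : List ι) {F : ι → Pt → ℝ}
    (h : ∀ p, IsSchwartz (F p)) : IsSchwartz fun x => (l.map fun p => F p x).sum := by
  induction l with
  | nil => simpa using IsSchwartz.zero
  | cons a l ih => simpa using (h a).add ih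

theorem pd_list_sum {ι : Type*} (i : Fin 3) (l : List ι) {F : ι → Pt → ℝ}
    (h : ∀ p, IsSchwartz (F p)) :
    pd i (fun x => (l.map fun p => F p x).sum) = fun x => (l.map fun p => pd i (F p) x).sum := by
  induction l with
  | nil =>
    funext x
    simp [pd]
  | cons a l ih =>
    simp only [List.map_cons, List.sum_cons]
    rw [pd_add i (h a) (IsSchwartz.list_sum l h), ih]

theorem integral_list_sum {ι : Type*} (l : List ι) {F : ι → Pt → ℝ}
    (h : ∀ p, IsSchwartz (F p)) :
    ∫ x, (l.map fun p => F p x).sum = (l.map fun p => ∫ x, F p x).sum := by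
  induction l with
  | nil => simp
  | cons a l ih =>
    simp only [List.map_cons, List.sum_cons]
    rw [integral_add (h a).integrable (IsSchwartz.list_sum l h).integrable, ih]

theorem iterPd_sum {ι : Type*} (s : Finset ι) (L : List (Fin 3)) {F : ι → Pt → ℝ}
    (h : ∀ j, IsSchwartz (F j)) :
    iterPd L (fun x => ∑ j ∈ s, F j x) = fun x => ∑ j ∈ s, iterPd L (F j) x := by
  induction L with
  | nil => rfl
  | cons i L ih => simp only [iterPd_cons, ih, pd_sum s i fun j => (h j).iterPd L]

/-- The ways of distributing a list of derivatives over a product, with at least one derivative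
on the first factor. -/
def splits : List (Fin 3) → List (List (Fin 3) × List (Fin 3))
  | [] => []
  | i :: L => ([i], L) :: ((splits L).map (fun p => (i :: p.1, p.2)) ++
      (splits L).map fun p => (p.1, i :: p.2))

theorem length_splits (L : List (Fin 3)) : (splits L).length + 1 = 2 ^ L.length := by
  induction L with
  | nil => rfl
  | cons i L ih =>
    simp only [splits, List.length_cons, List.length_append, List.length_map, pow_succ]
    omega

theorem fst_ne_nil_of_mem_splits {L : List (Fin 3)} {p : List (Fin 3) × List (Fin 3)}
    (h : p ∈ splits L) : p.1 ≠ [] ∧ p.1.length + p.2.length = L.length := by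
  induction L generalizing p with
  | nil => simp [splits] at h
  | cons i L ih =>
    simp only [splits, List.mem_cons, List.mem_append, List.mem_map] at h
    rcases h with rfl | ⟨q, hq, rfl⟩ | ⟨q, hq, rfl⟩
    · simp [add_comm]
    · have := ih hq
      simp
      omega
    · have := ih hq
      simp [this.1]
      omega

/-- Leibniz formula. -/
theorem iterPd_mul (L : List (Fin 3)) {f g : Pt → ℝ} (hf : IsSchwartz f) (hg : IsSchwartz g) :
    iterPd L (fun x => f x * g x) = fun x => f x * iterPd L g x +
      ((splits L).map fun p => iterPd p.1 f x * iterPd p.2 g x).sum := by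
  induction L with
  | nil =>
    funext x
    simp [splits, iterPd_nil]
  | cons i L ih =>
    have hs : ∀ p : List (Fin 3) × List (Fin 3),
        IsSchwartz fun x => iterPd p.1 f x * iterPd p.2 g x :=
      fun p => (hf.iterPd p.1).mul (hg.iterPd p.2)
    rw [iterPd_cons, ih, pd_add i (hf.mul (hg.iterPd L)) (IsSchwartz.list_sum _ hs),
      pd_list_sum i _ hs, pd_mul i hf (hg.iterPd L)]
    funext x
    simp only [fun p : List (Fin 3) × List (Fin 3) =>
      pd_mul i (hf.iterPd p.1) (hg.iterPd p.2), splits, List.map_cons, List.map_append,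
      List.map_map, List.sum_cons, List.sum_append, List.sum_map_add, Function.comp_def,
      iterPd_cons, iterPd_nil]
    ring

theorem abs_list_sum_le {ι : Type*} (l : List ι) {F : ι → ℝ} {M : ℝ}
    (h : ∀ p ∈ l, |F p| ≤ M) : |(l.map F).sum| ≤ l.length * M := by
  induction l with
  | nil => simp
  | cons a l ih =>
    simp only [List.map_cons, List.sum_cons, List.length_cons]
    have h1 := h a (by simp)
    have h2 := ih fun p hp => h p (by simp [hp])
    calc _ ≤ |F a| + |(l.map F).sum| := abs_add_le _ _
      _ ≤ _ := by
        push_cast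
        linarith

theorem iterPd_pd {f : Pt → ℝ} (hf : IsSchwartz f) (L : List (Fin 3)) (i : Fin 3) :
    iterPd L (pd i f) = pd i (iterPd L f) := by
  rw [← iterPd_cons, ← iterPd_perm hf (L := L ++ [i]) (by simp), iterPd_append]
  rfl

/-- Transport by a divergence free field is skew-symmetric. -/
theorem integral_transport_eq_zero {v : Fin 3 → Pt → ℝ} (hv : ∀ j, IsSchwartz (v j))
    (hdiv : ∀ x, ∑ i, pd i (v i) x = 0) {F : Pt → ℝ} (hF : IsSchwartz F) :
    ∫ x, (∑ j, v j x * pd j F x) * F x = 0 := by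
  have h1 : ∀ j, ∫ x, v j x * pd j (fun y => F y ^ 2) x = -∫ x, pd j (v j) x * F x ^ 2 :=
    fun j => integral_pd_mul j (hv j) (hF.pow 1)
  have h2 : ∑ j, ∫ x, v j x * pd j (fun y => F y ^ 2) x = 0 := by
    simp only [h1, Finset.sum_neg_distrib]
    rw [← integral_finsetSum _ fun j _ => (((hv j).pd j).mul (hF.pow 1)).integrable]
    simp [← Finset.sum_mul, hdiv]
  rw [← integral_finsetSum _ fun j _ => ((hv j).mul ((hF.pow 1).pd j)).integrable] at h2
  have h3 : ∫ x, (2 : ℝ) * ((∑ j, v j x * pd j F x) * F x) = 0 := by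
    rw [← h2]
    congr 1
    funext x
    simp only [pd_pow _ 2 hF, Finset.sum_mul, Finset.mul_sum]
    refine Finset.sum_congr rfl fun j _ => ?_
    push_cast
    ring
  rw [integral_const_mul] at h3
  linarith

/-- `∫ D_L (v · ∇ψ) D_L ψ`. -/
def transportForm (v : Fin 3 → Pt → ℝ) (ψ : Pt → ℝ) (L : List (Fin 3)) : ℝ :=
  ∫ x, iterPd L (fun y => ∑ j, v j y * pd j ψ y) x * iterPd L ψ x

theorem isSchwartz_transport {v : Fin 3 → Pt → ℝ} {ψ : Pt → ℝ} (hv : ∀ j, IsSchwartz (v j))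
    (hψ : IsSchwartz ψ) : IsSchwartz fun y => ∑ j, v j y * pd j ψ y :=
  IsSchwartz.sum _ fun j => (hv j).mul (hψ.pd j)

theorem hInner_lapl_eq {f ψ : Pt → ℝ} (k : ℕ) (hf : IsSchwartz f) (hψ : IsSchwartz ψ) :
    hInner k f (lapl ψ) =
      -∑ α ∈ midx k, ∑ i, ∫ x, iterPd (i :: dirs α) f x * iterPd (i :: dirs α) ψ x := by
  rw [hInner, ← Finset.sum_neg_distrib]
  refine Finset.sum_congr rfl fun α _ => ?_
  rw [pdM_eq_iterPd, pdM_eq_iterPd, ← Finset.sum_neg_distrib]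
  have h1 : lapl ψ = fun x => ∑ i, pd i (pd i ψ) x := rfl
  rw [h1, iterPd_sum _ _ fun i => (hψ.pd i).pd i]
  simp only [Finset.mul_sum]
  rw [integral_finsetSum _ fun i _ => ((hf.iterPd _).mul (((hψ.pd i).pd i).iterPd _)).integrable]
  refine Finset.sum_congr rfl fun i _ => ?_
  rw [iterPd_pd (hψ.pd i), iterPd_pd hψ, integral_pd_mul i (hf.iterPd _) ((hψ.iterPd _).pd i)]
  rfl

theorem transportForm_eq {v : Fin 3 → Pt → ℝ} {ψ : Pt → ℝ} (hv : ∀ j, IsSchwartz (v j))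
    (hψ : IsSchwartz ψ) (hdiv : ∀ x, ∑ i, pd i (v i) x = 0) (L : List (Fin 3)) :
    transportForm v ψ L = ∑ j, ((splits L).map fun p =>
      ∫ x, iterPd p.1 (v j) x * iterPd (p.2 ++ [j]) ψ x * iterPd L ψ x).sum := by
  have h0 := integral_transport_eq_zero hv hdiv (hψ.iterPd L)
  have hs : ∀ (j : Fin 3) (p : List (Fin 3) × List (Fin 3)),
      IsSchwartz fun x => iterPd p.1 (v j) x * iterPd (p.2 ++ [j]) ψ x * iterPd L ψ x :=
    fun j p => (((hv j).iterPd _).mul (hψ.iterPd _)).mul (hψ.iterPd _)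
  have h1 : transportForm v ψ L = ∫ x, ((∑ j, v j x * pd j (iterPd L ψ) x) * iterPd L ψ x +
      ∑ j, ((splits L).map fun p =>
        iterPd p.1 (v j) x * iterPd (p.2 ++ [j]) ψ x * iterPd L ψ x).sum) := by
    rw [transportForm, iterPd_sum _ _ fun j => (hv j).mul (hψ.pd j)]
    congr 1
    funext x
    simp only [iterPd_mul L (hv _) (hψ.pd _), iterPd_pd hψ L, Finset.sum_add_distrib, add_mul]
    congr 1
    rw [Finset.sum_mul]
    refine Finset.sum_congr rfl fun j _ => ?_
    rw [← List.sum_map_mul_right]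
    simp only [iterPd_append]
    rfl
  rw [h1, integral_add ((isSchwartz_transport hv (hψ.iterPd L)).mul (hψ.iterPd L)).integrable
    (IsSchwartz.sum _ fun j => IsSchwartz.list_sum _ (hs j)).integrable, h0, zero_add,
    integral_finsetSum _ fun j _ => (IsSchwartz.list_sum _ (hs j)).integrable]
  exact Finset.sum_congr rfl fun j _ => integral_list_sum _ (hs j)

/-! ### The `H²` form at a fixed time -/

theorem div_free_pd {u : Fin 3 → Pt → ℝ} (hu : ∀ j, IsSchwartz (u j))
    (hdiv : ∀ x, ∑ i, pd i (u i) x = 0) (k : Fin 3) (x : Pt) :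
    ∑ i, pd i (pd k (u i)) x = 0 := by
  have h1 : pd k (fun x => ∑ i, pd i (u i) x) = 0 := by
    rw [funext hdiv]
    funext y
    simp [pd]
  rw [pd_sum _ k fun i => (hu i).pd i] at h1
  simp only [fun i => pd_comm i k (hu i).1]
  exact congrFun h1 x

/-- Trading a vertical derivative of a divergence free field for horizontal ones. -/
theorem integral_pd_vert_mul {u : Fin 3 → Pt → ℝ} {F G : Pt → ℝ} (hu : ∀ j, IsSchwartz (u j))
    (hdiv : ∀ x, ∑ i, pd i (u i) x = 0) (hF : IsSchwartz F) (hG : IsSchwartz G) :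
    ∫ x, pd 2 (u 2) x * F x * G x =
      (∫ x, u 0 x * pd 0 F x * G x) + (∫ x, u 0 x * F x * pd 0 G x) +
      (∫ x, u 1 x * pd 1 F x * G x) + ∫ x, u 1 x * F x * pd 1 G x := by
  have key : ∀ j, ∫ x, pd j (u j) x * F x * G x =
      -((∫ x, u j x * pd j F x * G x) + ∫ x, u j x * F x * pd j G x) := by
    intro j
    rw [← integral_add (((hu j).mul (hF.pd j)).mul hG).integrable
      (((hu j).mul hF).mul (hG.pd j)).integrable]
    have := integral_pd_mul j (hu j) (hF.mul hG)
    rw [pd_mul j hF hG] at this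
    simp only [mul_assoc, ← mul_add]
    linarith
  have h0 : ∀ x, pd 2 (u 2) x * F x * G x =
      -(pd 0 (u 0) x * F x * G x + pd 1 (u 1) x * F x * G x) := by
    intro x
    have := hdiv x
    rw [Fin.sum_univ_three] at this
    rw [show pd 2 (u 2) x = -(pd 0 (u 0) x + pd 1 (u 1) x) by linarith]
    ring
  simp only [h0]
  rw [integral_neg, integral_add ((((hu 0).pd 0).mul hF).mul hG).integrable
    ((((hu 1).pd 1).mul hF).mul hG).integrable, key, key]
  ring

namespace FlowBounds

variable {v : Fin 3 → Pt → ℝ} {ψ : Pt → ℝ} {A b E : ℝ}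

theorem div_free_pd_two (H : FlowBounds v ψ A b E) (x : Pt) : ∑ i, pd i (pd 2 (v i)) x = 0 :=
  div_free_pd H.hv H.div_free 2 x

theorem div_free_pd_two_two (H : FlowBounds v ψ A b E) (x : Pt) :
    ∑ i, pd i (pd 2 (pd 2 (v i))) x = 0 :=
  div_free_pd (fun j => (H.hv j).pd 2) H.div_free_pd_two 2 x

theorem l2_vert₁ (H : FlowBounds v ψ A b E) : L2LE (pd 2 ψ) E := H.l2_ψ [2] (by simp) (by simp)

theorem l2_vert₂ (H : FlowBounds v ψ A b E) : L2LE (pd 2 (pd 2 ψ)) E :=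
  H.l2_ψ [2, 2] (by simp) (by simp)

theorem l2_vert₃ (H : FlowBounds v ψ A b E) : L2LE (pd 2 (pd 2 (pd 2 ψ))) E :=
  H.l2_ψ [2, 2, 2] (by simp) (by simp)

theorem l2_hor₂ (H : FlowBounds v ψ A b E) {h : Fin 3} (hh : h ≠ 2) :
    L2LE (pd h (pd 2 ψ)) b :=
  H.l2_ψ_hor [h, 2] (by simp) (by simp) (horizontal_cons_of_ne hh _)

theorem l2_hor₃ (H : FlowBounds v ψ A b E) {h : Fin 3} (hh : h ≠ 2) :
    L2LE (pd h (pd 2 (pd 2 ψ))) b :=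
  H.l2_ψ_hor [h, 2, 2] (by simp) (by simp) (horizontal_cons_of_ne hh _)

theorem l4_vert₂ (H : FlowBounds v ψ A b E) : L4LE (pd 2 (pd 2 ψ)) (3 * E) :=
  (H.l4_ψ (L := [2, 2]) rfl).mono (by linarith [H.psiSize_le [2, 2]])

theorem l4_hor₂ (H : FlowBounds v ψ A b E) {h : Fin 3} (hh : h ≠ 2) :
    L4LE (pd h (pd 2 ψ)) (3 * b) := by
  have := H.l4_ψ (L := [h, 2]) rfl
  rwa [psiSize_hor (horizontal_cons_of_ne hh _)] at this

theorem sup_vert_le (H : FlowBounds v ψ A b E) : SupLE (pd 2 ψ) (40 * E) := fun x =>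
  (H.sup_ψ 2 x).trans (by linarith [H.psiSize_le [2]])

/-- Integrals of type `sup`-`L²`-`L²` with a derivative of `v` of order at most one. -/
theorem abs_integral_vert_le {u : Fin 3 → Pt → ℝ} {F G : Pt → ℝ}
    (hu : ∀ j, IsSchwartz (u j)) (hdiv : ∀ x, ∑ i, pd i (u i) x = 0)
    (hsup : ∀ j, SupLE (u j) (40 * A)) (hF : IsSchwartz F) (hG : IsSchwartz G)
    (hFE : L2LE F E) (hGE : L2LE G E) (hFb : ∀ h, h ≠ 2 → L2LE (pd h F) b)
    (hGb : ∀ h, h ≠ 2 → L2LE (pd h G) b) :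
    |∫ x, pd 2 (u 2) x * F x * G x| ≤ 160 * (A * b * E) := by
  rw [integral_pd_vert_mul hu hdiv hF hG]
  have h1 : ∀ h, h ≠ 2 → |∫ x, u h x * pd h F x * G x| ≤ 40 * A * b * E := fun h hh =>
    abs_integral_sup_le (hu h) (hF.pd h) hG (hsup h) (hFb h hh) hGE
  have h2 : ∀ h, h ≠ 2 → |∫ x, u h x * F x * pd h G x| ≤ 40 * A * E * b := fun h hh =>
    abs_integral_sup_le (hu h) hF (hG.pd h) (hsup h) hFE (hGb h hh)
  have h10 := abs_le.1 (h1 0 (by decide))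
  have h11 := abs_le.1 (h1 1 (by decide))
  have h20 := abs_le.1 (h2 0 (by decide))
  have h21 := abs_le.1 (h2 1 (by decide))
  exact abs_le.2 ⟨by linarith, by linarith⟩

theorem abs_vert₁ (H : FlowBounds v ψ A b E) :
    |∫ x, pd 2 (v 2) x * pd 2 ψ x * pd 2 ψ x| ≤ 160 * (A * b * E) :=
  abs_integral_vert_le H.hv H.div_free (fun j => H.sup_v j (L := []) (by simp)) (H.hψ.pd 2)
    (H.hψ.pd 2) H.l2_vert₁ H.l2_vert₁ (fun _ => H.l2_hor₂) fun _ => H.l2_hor₂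

theorem abs_vert₂ (H : FlowBounds v ψ A b E) :
    |∫ x, pd 2 (v 2) x * pd 2 (pd 2 ψ) x * pd 2 (pd 2 ψ) x| ≤ 160 * (A * b * E) :=
  abs_integral_vert_le H.hv H.div_free (fun j => H.sup_v j (L := []) (by simp))
    ((H.hψ.pd 2).pd 2) ((H.hψ.pd 2).pd 2) H.l2_vert₂ H.l2_vert₂ (fun _ => H.l2_hor₃)
    fun _ => H.l2_hor₃

theorem abs_vert₃ (H : FlowBounds v ψ A b E) :
    |∫ x, pd 2 (pd 2 (v 2)) x * pd 2 ψ x * pd 2 (pd 2 ψ) x| ≤ 160 * (A * b * E) :=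
  abs_integral_vert_le (u := fun j => pd 2 (v j)) (fun j => (H.hv j).pd 2) H.div_free_pd_two
    (fun j => H.sup_v j (L := [2]) (by simp)) (H.hψ.pd 2) ((H.hψ.pd 2).pd 2) H.l2_vert₁ H.l2_vert₂
    (fun _ => H.l2_hor₂) fun _ => H.l2_hor₃

theorem abs_integral_l4_vert (H : FlowBounds v ψ A b E) {h : Fin 3} (hh : h ≠ 2) :
    |∫ x, pd 2 (pd 2 (v h)) x * pd 2 (pd 2 ψ) x * pd h (pd 2 (pd 2 ψ)) x| ≤ 9 * (A * b * E) := by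
  have := abs_integral_l4_le (((H.hv h).pd 2).pd 2) ((H.hψ.pd 2).pd 2)
    (((H.hψ.pd 2).pd 2).pd h) (H.l4_v h (L := [2, 2]) (by simp) (by simp)) H.l4_vert₂
    (H.l2_hor₃ hh)
  linarith

theorem abs_vert₄ (H : FlowBounds v ψ A b E) :
    |∫ x, pd 2 (pd 2 (v 2)) x * pd 2 (pd 2 ψ) x * pd 2 (pd 2 (pd 2 ψ)) x|
      ≤ 18 * (A * b * E) := by
  have hs := (H.hψ.pd 2).pd 2
  have hd : ∀ j, IsSchwartz (pd 2 (pd 2 (v j))) := fun j => ((H.hv j).pd 2).pd 2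
  have h1 := integral_pd_vert_mul hd H.div_free_pd_two_two hs hs
  have h2 := integral_pd_mul 2 (hd 2) (hs.mul hs)
  rw [pd_mul 2 hs hs] at h2
  have h3 : ∫ x, pd 2 (pd 2 (v 2)) x * (pd 2 (pd 2 (pd 2 ψ)) x * pd 2 (pd 2 ψ) x +
      pd 2 (pd 2 ψ) x * pd 2 (pd 2 (pd 2 ψ)) x) =
      2 * ∫ x, pd 2 (pd 2 (v 2)) x * pd 2 (pd 2 ψ) x * pd 2 (pd 2 (pd 2 ψ)) x := by
    rw [← integral_const_mul]
    congr 1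
    funext x
    ring
  have h4 : ∀ h, ∫ x, pd 2 (pd 2 (v h)) x * pd h (pd 2 (pd 2 ψ)) x * pd 2 (pd 2 ψ) x =
      ∫ x, pd 2 (pd 2 (v h)) x * pd 2 (pd 2 ψ) x * pd h (pd 2 (pd 2 ψ)) x := by
    intro h
    congr 1
    funext x
    ring
  rw [h4, h4] at h1
  simp only [← mul_assoc] at h2
  rw [h3] at h2
  have h5 := abs_le.1 (H.abs_integral_l4_vert (h := 0) (by decide))
  have h6 := abs_le.1 (H.abs_integral_l4_vert (h := 1) (by decide))
  exact abs_le.2 ⟨by linarith, by linarith⟩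

theorem abs_vert₅ (H : FlowBounds v ψ A b E) :
    |∫ x, pd 2 (pd 2 (pd 2 (v 2))) x * pd 2 ψ x * pd 2 (pd 2 (pd 2 ψ)) x|
      ≤ 116 * (A * b * E) := by
  have hs := H.hψ.pd 2
  have hq := (hs.pd 2).pd 2
  have hd : ∀ j, IsSchwartz (pd 2 (pd 2 (v j))) := fun j => ((H.hv j).pd 2).pd 2
  rw [integral_pd_vert_mul hd H.div_free_pd_two_two hs hq]
  have h1 : ∀ h, h ≠ 2 → |∫ x, pd 2 (pd 2 (v h)) x * pd h (pd 2 ψ) x * pd 2 (pd 2 (pd 2 ψ)) x|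
      ≤ 9 * (A * b * E) := by
    intro h hh
    have := abs_integral_l4_le (hd h) (hs.pd h) hq
      (H.l4_v h (L := [2, 2]) (by simp) (by simp)) (H.l4_hor₂ hh) H.l2_vert₃
    linarith
  have h2 : ∀ h, h ≠ 2 → |∫ x, pd 2 (pd 2 (v h)) x * pd 2 ψ x * pd h (pd 2 (pd 2 (pd 2 ψ))) x|
      ≤ 49 * (A * b * E) := by
    intro h hh
    have h3 := integral_pd_mul 2 ((hd h).mul hs) ((hs.pd 2).pd h)
    rw [pd_mul 2 (hd h) hs, pd_comm 2 h (hs.pd 2).1] at h3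
    simp only [add_mul] at h3
    rw [integral_add (((((hd h).pd 2).mul hs).mul ((hs.pd 2).pd h))).integrable
      (((hd h).mul (hs.pd 2)).mul ((hs.pd 2).pd h)).integrable] at h3
    have h4 := abs_le.1 (H.abs_integral_l4_vert hh)
    have h5 := abs_integral_sup_le hs ((hd h).pd 2) ((hs.pd 2).pd h) H.sup_vert_le
      (H.l2_v h [2, 2, 2] (by simp) (by simp)) (H.l2_hor₃ hh)
    simp only [mul_comm (pd 2 ψ _)] at h5
    have h6 : _ ≤ ∫ x, pd 2 (pd 2 (pd 2 (v h))) x * pd 2 ψ x * pd h (pd 2 (pd 2 ψ)) x ∧ _ :=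
      abs_le.1 h5
    rw [h3]
    exact abs_le.2 ⟨by linarith, by linarith⟩
  have h10 := abs_le.1 (h1 0 (by decide))
  have h11 := abs_le.1 (h1 1 (by decide))
  have h20 := abs_le.1 (h2 0 (by decide))
  have h21 := abs_le.1 (h2 1 (by decide))
  exact abs_le.2 ⟨by linarith, by linarith⟩

theorem abs_sum_splits_le (H : FlowBounds v ψ A b E) {L : List (Fin 3)} (hL : L.length ≤ 3)
    {j : Fin 3} (hj : j ≠ 2 ∨ Horizontal L) :
    |((splits L).map fun p =>
      ∫ x, iterPd p.1 (v j) x * iterPd (p.2 ++ [j]) ψ x * iterPd L ψ x).sum|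
      ≤ 280 * (A * b * E) := by
  have h0 : 0 ≤ A * b * E := mul_nonneg (mul_nonneg H.A_nonneg H.b_nonneg) H.E_nonneg
  have h1 := abs_list_sum_le (splits L) (M := 40 * (A * b * E)) (F := fun p =>
      ∫ x, iterPd p.1 (v j) x * iterPd (p.2 ++ [j]) ψ x * iterPd L ψ x) fun p hp => by
    have h2 := fst_ne_nil_of_mem_splits hp
    refine H.abs_integral_le j h2.1 (by simp) (by simp; omega) hL ?_
    exact hj.imp_left fun hj => ⟨j, by simp, hj⟩
  have h3 : (splits L).length ≤ 7 := by
    have h4 := length_splits L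
    have h5 : 2 ^ L.length ≤ 2 ^ 3 := Nat.pow_le_pow_right (by norm_num) hL
    omega
  have h6 : ((splits L).length : ℝ) ≤ 7 := by exact_mod_cast h3
  calc _ ≤ _ := h1
    _ ≤ 7 * (40 * (A * b * E)) := by gcongr
    _ = _ := by ring

theorem abs_transportForm_le (H : FlowBounds v ψ A b E) {L : List (Fin 3)} (hL0 : L ≠ [])
    (hL : L.length ≤ 3) :
    |transportForm v ψ L - if L = [2, 2, 2] then
      3 * ∫ x, pd 2 (v 2) x * pd 2 (pd 2 (pd 2 ψ)) x * pd 2 (pd 2 (pd 2 ψ)) x else 0|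
      ≤ 2000 * (A * b * E) := by
  have h0 : 0 ≤ A * b * E := mul_nonneg (mul_nonneg H.A_nonneg H.b_nonneg) H.E_nonneg
  rw [transportForm_eq H.hv H.hψ H.div_free, Fin.sum_univ_three]
  have h1 := abs_le.1 (H.abs_sum_splits_le hL (j := 0) (Or.inl (by decide)))
  have h2 := abs_le.1 (H.abs_sum_splits_le hL (j := 1) (Or.inl (by decide)))
  by_cases hor : Horizontal L
  · have h3 := abs_le.1 (H.abs_sum_splits_le hL (j := 2) (Or.inr hor))
    have h4 : L ≠ [2, 2, 2] := by
      rintro rfl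
      obtain ⟨i, hi, hi2⟩ := hor
      simp at hi
      exact hi2 hi
    rw [if_neg h4]
    exact abs_le.2 ⟨by linarith, by linarith⟩
  · have h3 : L = List.replicate L.length 2 :=
      List.eq_replicate_of_mem fun i hi => by_contra fun hi2 => hor ⟨i, hi, hi2⟩
    have h4 := List.length_pos_of_ne_nil hL0
    rcases (by omega : L.length = 1 ∨ L.length = 2 ∨ L.length = 3) with h | h | h <;> rw [h] at h3
    · obtain rfl : L = [2] := h3
      have h5 := abs_le.1 H.abs_vert₁
      simp [splits, iterPd] at h1 h2 ⊢
      exact abs_le.2 ⟨by linarith, by linarith⟩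
    · obtain rfl : L = [2, 2] := h3
      have h5 := abs_le.1 H.abs_vert₂
      have h6 := abs_le.1 H.abs_vert₃
      simp [splits, iterPd] at h1 h2 ⊢
      exact abs_le.2 ⟨by linarith, by linarith⟩
    · obtain rfl : L = [2, 2, 2] := h3
      have h5 := abs_le.1 H.abs_vert₄
      have h6 := abs_le.1 H.abs_vert₅
      simp [splits, iterPd] at h1 h2 ⊢
      exact abs_le.2 ⟨by linarith, by linarith⟩

end FlowBounds

/-- Number of occurrences of the purely vertical third order form in `(v·∇ψ|Δψ)_{H²}`. -/
def vertCount : ℝ := ∑ α ∈ midx 2, ∑ i : Fin 3, if i :: dirs α = [2, 2, 2] then 3 else 0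

theorem FlowBounds.abs_hInner_le {v : Fin 3 → Pt → ℝ} {ψ : Pt → ℝ} {A b E : ℝ}
    (H : FlowBounds v ψ A b E) :
    |hInner 2 (fun x => ∑ j, v j x * pd j ψ x) (lapl ψ) + vertCount *
      ∫ x, pd 2 (v 2) x * pd 2 (pd 2 (pd 2 ψ)) x * pd 2 (pd 2 (pd 2 ψ)) x|
      ≤ (midx 2).card * 6000 * (A * b * E) := by
  set K := ∫ x, pd 2 (v 2) x * pd 2 (pd 2 (pd 2 ψ)) x * pd 2 (pd 2 (pd 2 ψ)) x with hK
  rw [hInner_lapl_eq 2 (isSchwartz_transport H.hv H.hψ) H.hψ]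
  have h1 : -(∑ α ∈ midx 2, ∑ i, transportForm v ψ (i :: dirs α)) + vertCount * K =
      -∑ α ∈ midx 2, ∑ i, (transportForm v ψ (i :: dirs α) -
        if i :: dirs α = [2, 2, 2] then 3 * K else 0) := by
    simp only [Finset.sum_sub_distrib, vertCount, Finset.sum_mul, ite_mul, zero_mul]
    ring
  have h2 : ∀ α ∈ midx 2, |∑ i, (transportForm v ψ (i :: dirs α) -
      if i :: dirs α = [2, 2, 2] then 3 * K else 0)| ≤ 6000 * (A * b * E) := by
    intro α hα
    calc _ ≤ ∑ i : Fin 3, |transportForm v ψ (i :: dirs α) -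
          if i :: dirs α = [2, 2, 2] then 3 * K else 0| := Finset.abs_sum_le_sum_abs _ _
      _ ≤ ∑ _i : Fin 3, 2000 * (A * b * E) := Finset.sum_le_sum fun i _ =>
          H.abs_transportForm_le (by simp) (by
            rw [List.length_cons, length_dirs]
            have := mem_midx.1 hα
            omega)
      _ = _ := by
          simp
          ring
  change |-(∑ α ∈ midx 2, ∑ i, transportForm v ψ (i :: dirs α)) + vertCount * K| ≤ _
  rw [h1, abs_neg]
  calc _ ≤ ∑ α ∈ midx 2, |∑ i, (transportForm v ψ (i :: dirs α) -
      if i :: dirs α = [2, 2, 2] then 3 * K else 0)| := Finset.abs_sum_le_sum_abs _ _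
    _ ≤ ∑ _α ∈ midx 2, 6000 * (A * b * E) := Finset.sum_le_sum h2
    _ = _ := by
      rw [Finset.sum_const, nsmul_eq_mul]
      ring

/-! ### Bounds in terms of Sobolev norms -/

theorem l2LE_sqrt {f : Pt → ℝ} {M : ℝ} (h : l2Sq f ≤ M) : L2LE f √M :=
  ⟨Real.sqrt_nonneg _, by rwa [Real.sq_sqrt ((l2Sq_nonneg f).trans h)]⟩

theorem gradHSq_nonneg (k : ℕ) (f : Pt → ℝ) : 0 ≤ gradHSq k f :=
  Finset.sum_nonneg fun _ _ => hSq_nonneg _ _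

theorem gradHHSq_nonneg (k : ℕ) (f : Pt → ℝ) : 0 ≤ gradHHSq k f :=
  Finset.sum_nonneg fun _ _ => Finset.sum_nonneg fun _ _ => hSq_nonneg _ _

theorem gradVecHSq_nonneg (k : ℕ) (v : Fin 3 → Pt → ℝ) : 0 ≤ gradVecHSq k v :=
  Finset.sum_nonneg fun _ _ => gradHSq_nonneg _ _

theorem l2Sq_iterPd_le_gradHSq {f : Pt → ℝ} (hf : IsSchwartz f) {k : ℕ} {L : List (Fin 3)}
    (h0 : L ≠ []) (hL : L.length ≤ k + 1) : l2Sq (iterPd L f) ≤ gradHSq k f := by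
  rw [← List.dropLast_append_getLast h0, iterPd_append]
  exact (l2Sq_iterPd_le (hf.pd (L.getLast h0)) (by simp; omega)).trans
    (Finset.single_le_sum (f := fun i => hSq k (pd i f)) (fun _ _ => hSq_nonneg _ _)
      (Finset.mem_univ _))

theorem l2Sq_iterPd_le_gradHHSq {f : Pt → ℝ} (hf : IsSchwartz f) {k : ℕ} {L : List (Fin 3)}
    (h2 : 2 ≤ L.length) (hL : L.length ≤ k + 2) (hor : Horizontal L) :
    l2Sq (iterPd L f) ≤ gradHHSq k f := by
  obtain ⟨h, hmem, hh⟩ := hor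
  have h1 : (L.erase h).length = L.length - 1 := List.length_erase_of_mem hmem
  have h0 : L.erase h ≠ [] := List.ne_nil_of_length_pos (by omega)
  have hp : L.Perm ((L.erase h).dropLast ++ [h, (L.erase h).getLast h0]) := by
    refine (List.perm_cons_erase hmem).trans ?_
    conv_lhs => rw [← List.dropLast_append_getLast h0]
    exact List.perm_middle.symm
  have hh' : h ∈ hIdx := by
    unfold hIdx
    fin_cases h <;> simp_all
  rw [iterPd_perm hf hp, iterPd_append]
  refine (l2Sq_iterPd_le ((hf.pd ((L.erase h).getLast h0)).pd h) (k := k) (by simp; omega)).trans ?_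
  exact (Finset.single_le_sum (f := fun j => hSq k (pd h (pd j f))) (fun _ _ => hSq_nonneg _ _)
    (Finset.mem_univ _)).trans (Finset.single_le_sum
      (f := fun i => ∑ j, hSq k (pd i (pd j f)))
      (fun _ _ => Finset.sum_nonneg fun _ _ => hSq_nonneg _ _) hh')

theorem flowBounds_of_isSchwartz {v : Fin 3 → Pt → ℝ} {ψ : Pt → ℝ} (hv : ∀ j, IsSchwartz (v j))
    (hψ : IsSchwartz ψ) (hdiv : ∀ x, ∑ i, pd i (v i) x = 0) :
    FlowBounds v ψ √(gradVecHSq 2 v) (min √(gradHHSq 1 ψ) √(gradHSq 2 ψ)) √(gradHSq 2 ψ) where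
  hv := hv
  hψ := hψ
  div_free := hdiv
  b_le := min_le_right _ _
  l2_v j L h0 hL := l2LE_sqrt <| (l2Sq_iterPd_le_gradHSq (hv j) h0 hL).trans <|
    Finset.single_le_sum (f := fun j => gradHSq 2 (v j)) (fun _ _ => gradHSq_nonneg _ _)
      (Finset.mem_univ _)
  l2_ψ L h0 hL := l2LE_sqrt (l2Sq_iterPd_le_gradHSq hψ h0 hL)
  l2_ψ_hor L h2 hL hor := by
    rcases min_choice √(gradHHSq 1 ψ) √(gradHSq 2 ψ) with h | h <;> rw [h]
    · exact l2LE_sqrt (l2Sq_iterPd_le_gradHHSq hψ h2 hL hor)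
    · exact l2LE_sqrt (l2Sq_iterPd_le_gradHSq hψ (List.ne_nil_of_length_pos (by omega)) hL)

/-! ### Weighted integrals -/

/-- Multipliers of the Schwartz class bounded by one. -/
def IsMult (χ : Pt → ℝ) : Prop :=
  (∀ f, IsSchwartz f → IsSchwartz fun x => χ x * f x) ∧ SupLE χ 1

/-- All integrals of the Schwartz function `f` against multipliers are bounded by `M`. -/
def AbsLE (f : Pt → ℝ) (M : ℝ) : Prop :=
  IsSchwartz f ∧ ∀ χ, IsMult χ → |∫ x, χ x * f x| ≤ M

namespace AbsLE

variable {f g h w : Pt → ℝ} {a b c M N : ℝ}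

theorem abs_integral_le (hf : AbsLE f M) : |∫ x, f x| ≤ M := by
  simpa using hf.2 (fun _ => 1) ⟨fun f hf => by simpa using hf, fun x => by simp⟩

theorem congr (hf : AbsLE f M) (h : ∀ x, f x = g x) (hMN : M ≤ N) : AbsLE g N := by
  obtain rfl : f = g := funext h
  exact ⟨hf.1, fun χ hχ => (hf.2 χ hχ).trans hMN⟩

theorem add (hf : AbsLE f M) (hg : AbsLE g N) : AbsLE (fun x => f x + g x) (M + N) := by
  refine ⟨hf.1.add hg.1, fun χ hχ => ?_⟩
  simp only [mul_add]
  rw [integral_add (hχ.1 f hf.1).integrable (hχ.1 g hg.1).integrable]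
  exact (abs_add_le _ _).trans (add_le_add (hf.2 χ hχ) (hg.2 χ hχ))

theorem const_mul (c : ℝ) (hf : AbsLE f M) : AbsLE (fun x => c * f x) (|c| * M) := by
  refine ⟨hf.1.const_mul c, fun χ hχ => ?_⟩
  have : ∫ x, χ x * (c * f x) = c * ∫ x, χ x * f x := by
    rw [← integral_const_mul]
    simp only [mul_left_comm]
  rw [this, abs_mul]
  exact mul_le_mul_of_nonneg_left (hf.2 χ hχ) (abs_nonneg c)

theorem sum {F : Fin 3 → Pt → ℝ} (hF : ∀ j, AbsLE (F j) M) :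
    AbsLE (fun x => ∑ j, F j x) (3 * M) :=
  (((hF 0).add (hF 1)).add (hF 2)).congr (fun x => by rw [Fin.sum_univ_three]) (by linarith)

theorem of_sup (hf : IsSchwartz f) (hg : IsSchwartz g) (hh : IsSchwartz h) (ha : SupLE f a)
    (hb : L2LE g b) (hc : L2LE h c) : AbsLE (fun x => f x * g x * h x) (a * b * c) := by
  refine ⟨(hf.mul hg).mul hh, fun χ hχ => ?_⟩
  have := abs_integral_sup_le (hχ.1 f hf) hg hh (hχ.2.mul ha) hb hc
  simpa only [one_mul, mul_assoc] using this

theorem of_l4 (hw : IsSchwartz w) (hf : IsSchwartz f) (hg : IsSchwartz g) (hh : IsSchwartz h)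
    (hN : SupLE w N) (ha : L4LE f a) (hb : L4LE g b) (hc : L2LE h c) :
    AbsLE (fun x => w x * f x * g x * h x) (N * a * b * c) := by
  refine ⟨((hw.mul hf).mul hg).mul hh, fun χ hχ => ?_⟩
  have h1 := abs_integral_l4_le hf hg (hχ.1 _ (hw.mul hh)) ha hb
    ((hχ.2.mul hN).l2_mul hc hh |> fun h2 => by simpa only [mul_assoc] using h2)
  calc _ = |∫ x, f x * g x * (χ x * (w x * h x))| := by
        congr 2
        funext x
        ring
    _ ≤ _ := h1
    _ = _ := by ring

end AbsLE

theorem IsSchwartz.mul_one_add {f g : Pt → ℝ} (hf : IsSchwartz f) (hg : IsSchwartz g) (c : ℝ) :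
    IsSchwartz fun x => f x * (1 + c * g x) := by
  have := hf.add ((hf.mul hg).const_mul c)
  convert this using 2
  ring

theorem SupLE.mul_one_add {f g : Pt → ℝ} {a b : ℝ} (hf : SupLE f a) (hg : SupLE g b) (c : ℝ) :
    SupLE (fun x => f x * (1 + c * g x)) (a * (1 + |c| * b)) :=
  hf.mul fun x => (abs_add_le _ _).trans (by
    rw [abs_one, abs_mul]
    gcongr
    exact hg x)

/-! ### The corrected vertical density -/

/-- The density `(s - 7/2 s²) (∂₃² s)²` with `s = ∂₃ψ`. -/
def vertDensity (ψ : Pt → ℝ) : Pt → ℝ := fun x =>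
  (pd 2 ψ x - 7 / 2 * pd 2 ψ x ^ 2) * pd 2 (pd 2 (pd 2 ψ)) x ^ 2

/-- The material derivative of `∂₃ψ`. -/
def vertRate₁ (v : Fin 3 → Pt → ℝ) (ψ : Pt → ℝ) : Pt → ℝ := fun x =>
  -(∑ j, pd 2 (v j) x * pd j ψ x) - pd 2 (v 2) x

/-- The material derivative of `∂₃³ψ`. -/
def vertRate₃ (v : Fin 3 → Pt → ℝ) (ψ : Pt → ℝ) : Pt → ℝ := fun x =>
  -(∑ j, (pd 2 (pd 2 (pd 2 (v j))) x * pd j ψ x + 3 * (pd 2 (pd 2 (v j)) x * pd j (pd 2 ψ) x) +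
    3 * (pd 2 (v j) x * pd j (pd 2 (pd 2 ψ)) x))) - pd 2 (pd 2 (pd 2 (v 2))) x

/-- The material derivative of `vertDensity ψ`. -/
def vertSource (v : Fin 3 → Pt → ℝ) (ψ : Pt → ℝ) : Pt → ℝ := fun x =>
  (1 - 7 * pd 2 ψ x) * pd 2 (pd 2 (pd 2 ψ)) x ^ 2 * vertRate₁ v ψ x +
    2 * (pd 2 ψ x - 7 / 2 * pd 2 ψ x ^ 2) * pd 2 (pd 2 (pd 2 ψ)) x * vertRate₃ v ψ x

namespace FlowBounds

variable {v : Fin 3 → Pt → ℝ} {ψ : Pt → ℝ} {A b E : ℝ}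

theorem absLE_vertSource_add (H : FlowBounds v ψ A b E) :
    AbsLE (fun x => vertSource v ψ x +
      pd 2 (v 2) x * pd 2 (pd 2 (pd 2 ψ)) x * pd 2 (pd 2 (pd 2 ψ)) x +
      2 * (pd 2 (pd 2 (pd 2 (v 2))) x * pd 2 ψ x * pd 2 (pd 2 (pd 2 ψ)) x))
      (10 ^ 7 * (A * b * E * (1 + E) ^ 2)) := by
  have hA := H.A_nonneg
  have hb := H.b_nonneg
  have hE := H.E_nonneg
  have hX : 0 ≤ A * b * E := mul_nonneg (mul_nonneg hA hb) hE
  have hs := H.hψ.pd 2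
  have hds := hs.pd 2
  have hq := hds.pd 2
  have hv := H.hv
  have hdv := fun j => (hv j).pd 2
  have hddv := fun j => (hdv j).pd 2
  have hdddv := fun j => (hddv j).pd 2
  have hψ := H.hψ
  have sv : ∀ j, SupLE (pd 2 (v j)) (40 * A) := fun j => H.sup_v j (L := [2]) (by simp)
  have ddv : ∀ j, L4LE (pd 2 (pd 2 (v j))) (3 * A) := fun j =>
    H.l4_v j (L := [2, 2]) (by simp) (by simp)
  have dddv : ∀ j, L2LE (pd 2 (pd 2 (pd 2 (v j)))) A := fun j =>
    H.l2_v j [2, 2, 2] (by simp) (by simp)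
  have sψ : ∀ h, h ≠ 2 → SupLE (pd h ψ) (40 * b) := fun h hh => by
    have := H.sup_ψ h
    rwa [psiSize_hor (horizontal_cons_of_ne hh _)] at this
  have t1 := AbsLE.of_sup ((hs.mul hs).mul (hdv 2)) hq hq ((H.sup_vert.mul H.sup_vert).mul (sv 2))
    H.l2_vert₃ H.l2_vert₃
  have t2 : ∀ h : Fin 3, h ≠ 2 → _ := fun h hh => AbsLE.of_sup (((hdv h).mul (hψ.pd h)).mul_one_add hs (-7))
    hq hq (((sv h).mul (sψ h hh)).mul_one_add H.sup_vert_le (-7)) H.l2_vert₃ H.l2_vert₃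
  have t3 := AbsLE.of_sup ((hs.mul hs).mul_one_add hs (7 / 5)) hq (hdddv 2)
    ((H.sup_vert.mul H.sup_vert).mul_one_add H.sup_vert_le (7 / 5)) H.l2_vert₃ (dddv 2)
  have t4 := AbsLE.of_l4 (hs.mul_one_add hs (-7 / 2)) (hddv 2) hds hq
    (H.sup_vert.mul_one_add H.sup_vert_le (-7 / 2)) (ddv 2) H.l4_vert H.l2_vert₃
  have t5 : ∀ h : Fin 3, h ≠ 2 → _ := fun h hh => AbsLE.of_sup
    ((hs.mul_one_add hs (-7 / 2)).mul (hψ.pd h)) hq (hdddv h)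
    ((H.sup_vert_le.mul_one_add H.sup_vert_le (-7 / 2)).mul (sψ h hh)) H.l2_vert₃ (dddv h)
  have t6 : ∀ h : Fin 3, h ≠ 2 → _ := fun h hh => AbsLE.of_l4 (hs.mul_one_add hs (-7 / 2)) (hddv h)
    (hs.pd h) hq (H.sup_vert_le.mul_one_add H.sup_vert_le (-7 / 2)) (ddv h) (H.l4_hor₂ hh)
    H.l2_vert₃
  have t7 : ∀ h : Fin 3, h ≠ 2 → _ := fun h hh => AbsLE.of_sup
    ((hs.mul_one_add hs (-7 / 2)).mul (hdv h)) hq (hds.pd h)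
    ((H.sup_vert_le.mul_one_add H.sup_vert_le (-7 / 2)).mul (sv h)) H.l2_vert₃ (H.l2_hor₃ hh)
  have n0 : (0 : Fin 3) ≠ 2 := by decide
  have n1 : (1 : Fin 3) ≠ 2 := by decide
  refine ((((((((((((t1.const_mul 28).add ((t2 0 n0).const_mul (-1))).add
    ((t2 1 n1).const_mul (-1))).add (t3.const_mul 5)).add (t4.const_mul (-6))).add
    ((t5 0 n0).const_mul (-2))).add ((t5 1 n1).const_mul (-2))).add
    ((t6 0 n0).const_mul (-6))).add ((t6 1 n1).const_mul (-6))).add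
    ((t7 0 n0).const_mul (-6))).add ((t7 1 n1).const_mul (-6)))).congr (fun x => ?_) ?_
  · simp only [vertSource, vertRate₁, vertRate₃, Fin.sum_univ_three]
    ring
  · have hr : √(E * b) * √(E * b) = E * b := Real.mul_self_sqrt (mul_nonneg hE hb)
    have e1 : 40 * √(E * b) * (40 * √(E * b)) = 1600 * (E * b) := by
      linear_combination 1600 * hr
    have e2 : 40 * √(E * b) * (1 + |(-7 / 2 : ℝ)| * (40 * E)) * (3 * A) * (3 * √(E * b)) * E =
      360 * (E * b) * (1 + |(-7 / 2 : ℝ)| * (40 * E)) * A * E := by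
      linear_combination 360 * (1 + |(-7 / 2 : ℝ)| * (40 * E)) * A * E * hr
    rw [e1, e2]
    norm_num [abs_of_nonneg, abs_of_neg, abs_div]
    nlinarith [mul_nonneg hX hE, mul_nonneg (mul_nonneg hX hE) hE]

theorem abs_integral_vertSource_add_le (H : FlowBounds v ψ A b E) :
    |(∫ x, vertSource v ψ x) +
      ∫ x, pd 2 (v 2) x * pd 2 (pd 2 (pd 2 ψ)) x * pd 2 (pd 2 (pd 2 ψ)) x| ≤
      2 * 10 ^ 7 * (A * b * E * (1 + E) ^ 2) := by
  have hE := H.E_nonneg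
  have hX : 0 ≤ A * b * E := mul_nonneg (mul_nonneg H.A_nonneg H.b_nonneg) hE
  have hq := ((H.hψ.pd 2).pd 2).pd 2
  have h1 := (((H.hv 2).pd 2).mul hq).mul hq
  have h2 := ((((((H.hv 2).pd 2).pd 2).pd 2).mul (H.hψ.pd 2)).mul hq).const_mul 2
  have h0 := H.absLE_vertSource_add
  have h3 : IsSchwartz (vertSource v ψ) := by
    convert (h0.1.sub h2).sub h1 using 2
    ring
  have h4 := h0.abs_integral_le
  rw [integral_add (h3.add h1).integrable h2.integrable, integral_add h3.integrable h1.integrable,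
    integral_const_mul] at h4
  have h5 := abs_le.1 H.abs_vert₅
  have h6 := abs_le.1 h4
  have h7 : A * b * E ≤ A * b * E * (1 + E) ^ 2 := le_mul_of_one_le_right hX (by nlinarith)
  exact abs_le.2 ⟨by linarith, by linarith⟩

theorem absLE_vertDensity (H : FlowBounds v ψ A b E) :
    AbsLE (vertDensity ψ) (10 ^ 4 * (E ^ 3 * (1 + E))) := by
  have hE := H.E_nonneg
  have hs := H.hψ.pd 2
  have hq := (hs.pd 2).pd 2
  refine (AbsLE.of_sup (hs.mul_one_add hs (-7 / 2)) hq hq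
    (H.sup_vert_le.mul_one_add H.sup_vert_le (-7 / 2)) H.l2_vert₃ H.l2_vert₃).congr
    (fun x => ?_) ?_
  · simp only [vertDensity]
    ring
  · norm_num [abs_of_nonneg, abs_of_neg, abs_div]
    nlinarith [pow_nonneg hE 3, pow_nonneg hE 4]

theorem absLE_vertSource (H : FlowBounds v ψ A b E) :
    AbsLE (vertSource v ψ) (10 ^ 8 * (A * E ^ 2 * (1 + E) ^ 3)) := by
  have hA := H.A_nonneg
  have hE := H.E_nonneg
  have hX : 0 ≤ A * E ^ 2 := by positivity
  have hs := H.hψ.pd 2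
  have hds := hs.pd 2
  have hq := hds.pd 2
  have hv := H.hv
  have hdv := fun j => (hv j).pd 2
  have hddv := fun j => (hdv j).pd 2
  have hdddv := fun j => (hddv j).pd 2
  have hψ := H.hψ
  have sv : ∀ j, SupLE (pd 2 (v j)) (40 * A) := fun j => H.sup_v j (L := [2]) (by simp)
  have ddv : ∀ j, L4LE (pd 2 (pd 2 (v j))) (3 * A) := fun j =>
    H.l4_v j (L := [2, 2]) (by simp) (by simp)
  have dddv : ∀ j, L2LE (pd 2 (pd 2 (pd 2 (v j)))) A := fun j =>
    H.l2_v j [2, 2, 2] (by simp) (by simp)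
  have sψ : ∀ j, SupLE (pd j ψ) (40 * E) := fun j x =>
    (H.sup_ψ j x).trans (by linarith [H.psiSize_le [j]])
  have fψ : ∀ j, L4LE (pd j (pd 2 ψ)) (3 * E) := fun j =>
    (H.l4_ψ (L := [j, 2]) rfl).mono (by linarith [H.psiSize_le [j, 2]])
  have lψ : ∀ j, L2LE (pd j (pd 2 (pd 2 ψ))) E := fun j => H.l2_ψ [j, 2, 2] (by simp) (by simp)
  have hg := hs.mul_one_add hs (-7 / 2)
  have sg := H.sup_vert_le.mul_one_add H.sup_vert_le (-7 / 2)
  have t1 := AbsLE.sum fun j => AbsLE.of_sup (((hdv j).mul (hψ.pd j)).mul_one_add hs (-7)) hq hq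
    (((sv j).mul (sψ j)).mul_one_add H.sup_vert_le (-7)) H.l2_vert₃ H.l2_vert₃
  have t2 := AbsLE.of_sup ((hdv 2).mul_one_add hs (-7)) hq hq
    ((sv 2).mul_one_add H.sup_vert_le (-7)) H.l2_vert₃ H.l2_vert₃
  have t3 := AbsLE.sum fun j => AbsLE.of_sup (hg.mul (hψ.pd j)) hq (hdddv j)
    (sg.mul (sψ j)) H.l2_vert₃ (dddv j)
  have t4 := AbsLE.sum fun j => AbsLE.of_l4 hg (hddv j) (hs.pd j) hq sg (ddv j) (fψ j) H.l2_vert₃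
  have t5 := AbsLE.sum fun j => AbsLE.of_sup (hg.mul (hdv j)) hq (hds.pd j)
    (sg.mul (sv j)) H.l2_vert₃ (lψ j)
  have t6 := AbsLE.of_sup hg hq (hdddv 2) sg H.l2_vert₃ (dddv 2)
  refine ((((((t1.const_mul (-1)).add (t2.const_mul (-1))).add (t3.const_mul (-2))).add
    (t4.const_mul (-6))).add (t5.const_mul (-6))).add (t6.const_mul (-2))).congr (fun x => ?_) ?_
  · simp only [vertSource, vertRate₁, vertRate₃, Fin.sum_univ_three]
    ring
  · norm_num [abs_of_nonneg, abs_of_neg, abs_div]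
    nlinarith [mul_nonneg hX hE, mul_nonneg (mul_nonneg hX hE) hE,
      mul_nonneg (mul_nonneg (mul_nonneg hX hE) hE) hE]

end FlowBounds

/-! ### Time regularity -/

theorem hasDerivAt_fderiv_prod {F : ℝ × Pt → ℝ} {t : ℝ} {x : Pt}
    (hF : ContDiffAt ℝ (⊤ : ℕ∞) F (t, x)) (e : Pt) :
    HasDerivAt (fun τ => fderiv ℝ F (τ, x) (0, e))
      (fderiv ℝ (fun y => fderiv ℝ F (t, y) (1, 0)) x e) t := by
  have hd : DifferentiableAt ℝ (fderiv ℝ F) (t, x) :=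
    (hF.fderiv_right (m := (⊤ : ℕ∞)) (by simp)).differentiableAt (by simp)
  have h1 : ∀ w, HasFDerivAt (fun q => fderiv ℝ F q w)
      ((ContinuousLinearMap.apply ℝ ℝ w).comp (fderiv ℝ (fderiv ℝ F) (t, x))) (t, x) := fun w =>
    (ContinuousLinearMap.apply ℝ ℝ w).hasFDerivAt.comp (t, x) hd.hasFDerivAt
  have h2 : HasDerivAt (fun τ : ℝ => (τ, x)) (1, 0) t :=
    (hasDerivAt_id t).prodMk (hasDerivAt_const _ _)
  have h3 : HasFDerivAt (fun y => fderiv ℝ F (t, y) (1, 0)) _ x :=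
    (h1 (1, 0)).comp x (hasFDerivAt_prodMk_right t x)
  have h4 : IsSymmSndFDerivAt ℝ F (t, x) := (hF.of_le (m := 2) (by norm_cast)).isSymmSndFDerivAt (by simp)
  rw [h3.fderiv]
  have h5 := (h1 (0, e)).comp_hasDerivAt t h2
  exact h5.congr_deriv (h4.eq (1, 0) (0, e))

namespace SmoothOn2

variable {T : ℝ} {f : ℝ → Pt → ℝ}

theorem hasFDerivAt_slice {s : Set ℝ} (hf : SmoothOn2 s f) {t : ℝ} (ht : t ∈ s) (x : Pt) :
    HasFDerivAt (f t) ((fderivWithin ℝ (fun q : ℝ × Pt => f q.1 q.2) (s ×ˢ univ) (t, x)).comp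
      (ContinuousLinearMap.inr ℝ ℝ Pt)) x := by
  have h1 := ((hf.differentiableOn (by simp)) (t, x) ⟨ht, mem_univ _⟩).hasFDerivWithinAt
  have h2 : HasFDerivWithinAt (fun y : Pt => (t, y)) (ContinuousLinearMap.inr ℝ ℝ Pt) univ x :=
    (hasFDerivAt_prodMk_right t x).hasFDerivWithinAt
  exact hasFDerivWithinAt_univ.1 (h1.comp x h2 fun y _ => ⟨ht, mem_univ _⟩)

theorem pd (hT : 0 < T) (hf : SmoothOn2 (Icc 0 T) f) (i : Fin 3) :
    SmoothOn2 (Icc 0 T) fun t => _root_.pd i (f t) := by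
  have h1 : ContDiffOn ℝ (⊤ : ℕ∞) (fun q : ℝ × Pt =>
      fderivWithin ℝ (fun q : ℝ × Pt => f q.1 q.2) (Icc 0 T ×ˢ univ) q (0, Pi.single i 1))
      (Icc 0 T ×ˢ univ) :=
    (hf.fderivWithin ((uniqueDiffOn_Icc hT).prod uniqueDiffOn_univ) (by simp)).clm_apply
      contDiffOn_const
  refine h1.congr fun q hq => ?_
  simp only [_root_.pd]
  rw [(hf.hasFDerivAt_slice hq.1 q.2).fderiv]
  rfl

theorem continuousOn {s : Set ℝ} (hf : SmoothOn2 s f) (x : Pt) :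
    ContinuousOn (fun t => f t x) s :=
  ContDiffOn.continuousOn hf |>.comp (f := fun t : ℝ => (t, x)) (by fun_prop) fun _ ht => ⟨ht, mem_univ _⟩

theorem contDiffAt (hf : SmoothOn2 (Icc 0 T) f) {t : ℝ} (ht : t ∈ Ioo 0 T) (x : Pt) :
    ContDiffAt ℝ (⊤ : ℕ∞) (fun q : ℝ × Pt => f q.1 q.2) (t, x) :=
  ContDiffOn.contDiffAt hf (prod_mem_nhds (Icc_mem_nhds ht.1 ht.2) univ_mem)

theorem hasDerivAt_fderiv (hf : SmoothOn2 (Icc 0 T) f) {t : ℝ} (ht : t ∈ Ioo 0 T) (x : Pt) :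
    HasDerivAt (fun τ => f τ x) (fderiv ℝ (fun q : ℝ × Pt => f q.1 q.2) (t, x) (1, 0)) t := by
  have h1 := ((hf.contDiffAt ht x).differentiableAt (by simp)).hasFDerivAt
  have h2 : HasDerivAt (fun τ : ℝ => (τ, x)) (1, 0) t := (hasDerivAt_id t).prodMk (hasDerivAt_const _ _)
  exact h1.comp_hasDerivAt t h2

/-- Space and time derivatives commute. -/
theorem hasDerivAt_pd (hf : SmoothOn2 (Icc 0 T) f) {t : ℝ} (ht : t ∈ Ioo 0 T)
    {r : Pt → ℝ} (hr : ∀ x, HasDerivAt (fun τ => f τ x) (r x) t) (i : Fin 3) (x : Pt) :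
    HasDerivAt (fun τ => _root_.pd i (f τ) x) (_root_.pd i r x) t := by
  have h1 : ∀ τ ∈ Ioo 0 T, ∀ y, _root_.pd i (f τ) y =
      fderiv ℝ (fun q : ℝ × Pt => f q.1 q.2) (τ, y) (0, Pi.single i 1) := by
    intro τ hτ y
    have h2 : HasFDerivAt (f τ) _ y :=
      ((hf.contDiffAt hτ y).differentiableAt (by simp)).hasFDerivAt.comp y
        (hasFDerivAt_prodMk_right τ y)
    exact congrArg (fun l : Pt →L[ℝ] ℝ => l (Pi.single i 1)) h2.fderiv
  have h3 : r = fun y => fderiv ℝ (fun q : ℝ × Pt => f q.1 q.2) (t, y) (1, 0) :=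
    funext fun y => (hr y).unique (hf.hasDerivAt_fderiv ht y)
  have h5 := hasDerivAt_fderiv_prod (hf.contDiffAt ht x) (Pi.single i 1)
  rw [h3]
  exact h5.congr_of_eventuallyEq (Filter.eventually_of_mem (Ioo_mem_nhds ht.1 ht.2)
    fun τ hτ => h1 τ hτ x)

end SmoothOn2

/-! ### The evolution of the vertical density -/

theorem pd_pd_pd_mul (i : Fin 3) {f g : Pt → ℝ} (hf : IsSchwartz f) (hg : IsSchwartz g) :
    pd i (pd i (pd i fun x => f x * g x)) = fun x => pd i (pd i (pd i f)) x * g x +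
      3 * (pd i (pd i f) x * pd i g x) + 3 * (pd i f x * pd i (pd i g) x) +
      f x * pd i (pd i (pd i g)) x := by
  have hf1 := hf.pd i
  have hg1 := hg.pd i
  have hf2 := hf1.pd i
  have hg2 := hg1.pd i
  rw [pd_mul i hf hg, pd_add i (hf1.mul hg) (hf.mul hg1), pd_mul i hf1 hg, pd_mul i hf hg1,
    pd_add i ((hf2.mul hg).add (hf1.mul hg1)) ((hf1.mul hg1).add (hf.mul hg2)),
    pd_add i (hf2.mul hg) (hf1.mul hg1), pd_add i (hf1.mul hg1) (hf.mul hg2), pd_mul i hf2 hg,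
    pd_mul i hf1 hg1, pd_mul i hf hg2]
  funext x
  ring

theorem pd_transport {v : Fin 3 → Pt → ℝ} {ψ : Pt → ℝ} (hv : ∀ j, IsSchwartz (v j))
    (hψ : IsSchwartz ψ) :
    pd 2 (fun x => -1 * ((∑ j, v j x * pd j ψ x) + v 2 x)) =
      fun x => vertRate₁ v ψ x - ∑ j, v j x * pd j (pd 2 ψ) x := by
  have h1 := isSchwartz_transport hv hψ
  rw [pd_const_mul 2 (-1) (h1.add (hv 2)), pd_add 2 h1 (hv 2),
    pd_sum _ 2 fun j => (hv j).mul (hψ.pd j)]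
  funext x
  simp only [fun j => pd_mul 2 (hv j) (hψ.pd j), fun j => pd_comm 2 j hψ.1, vertRate₁,
    Finset.sum_add_distrib]
  ring

theorem pd_pd_pd_transport {v : Fin 3 → Pt → ℝ} {ψ : Pt → ℝ} (hv : ∀ j, IsSchwartz (v j))
    (hψ : IsSchwartz ψ) :
    pd 2 (pd 2 (pd 2 fun x => -1 * ((∑ j, v j x * pd j ψ x) + v 2 x))) =
      fun x => vertRate₃ v ψ x - ∑ j, v j x * pd j (pd 2 (pd 2 (pd 2 ψ))) x := by
  have h1 := isSchwartz_transport hv hψ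
  have h2 := fun j => (hv j).mul (hψ.pd j)
  rw [pd_const_mul 2 (-1) (h1.add (hv 2)), pd_const_mul 2 (-1) ((h1.add (hv 2)).pd 2),
    pd_const_mul 2 (-1) (((h1.add (hv 2)).pd 2).pd 2), pd_add 2 h1 (hv 2),
    pd_add 2 (h1.pd 2) ((hv 2).pd 2), pd_add 2 ((h1.pd 2).pd 2) (((hv 2).pd 2).pd 2),
    pd_sum _ 2 h2, pd_sum _ 2 fun j => (h2 j).pd 2, pd_sum _ 2 fun j => ((h2 j).pd 2).pd 2]
  funext x
  simp only [fun j => pd_pd_pd_mul 2 (hv j) (hψ.pd j), vertRate₃,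
    fun j => pd_comm 2 j hψ.1, fun j => pd_comm 2 j (hψ.pd 2).1,
    fun j => pd_comm 2 j ((hψ.pd 2).pd 2).1, Finset.sum_add_distrib]
  ring

theorem pd_vertDensity {ψ : Pt → ℝ} (hψ : IsSchwartz ψ) (j : Fin 3) :
    pd j (vertDensity ψ) = fun x =>
      (1 - 7 * pd 2 ψ x) * pd 2 (pd 2 (pd 2 ψ)) x ^ 2 * pd j (pd 2 ψ) x +
      2 * (pd 2 ψ x - 7 / 2 * pd 2 ψ x ^ 2) * pd 2 (pd 2 (pd 2 ψ)) x *
        pd j (pd 2 (pd 2 (pd 2 ψ))) x := by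
  have hs := hψ.pd 2
  have hq := (hs.pd 2).pd 2
  have h2 := (hs.pow 1).const_mul (-(7 / 2))
  have h3 : vertDensity ψ = fun x => (pd 2 ψ x + -(7 / 2) * pd 2 ψ x ^ (1 + 1)) *
      pd 2 (pd 2 (pd 2 ψ)) x ^ (1 + 1) := by
    funext x
    simp only [vertDensity]
    ring
  rw [h3, pd_mul j (hs.add h2) (hq.pow 1), pd_add j hs h2, pd_const_mul j _ (hs.pow 1),
    pd_pow j _ hs, pd_pow j _ hq]
  funext x
  push_cast
  ring

/-- The vertical density satisfies a transport equation with source `vertSource`. -/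
theorem hasDerivAt_vertDensity {T : ℝ} {ψ : ℝ → Pt → ℝ} {v : Fin 3 → ℝ → Pt → ℝ} (hT : 0 < T)
    (hψ : SmoothOn2 (Icc 0 T) ψ) {t : ℝ} (ht : t ∈ Ioo 0 T) (hsψ : IsSchwartz (ψ t))
    (hsv : ∀ j, IsSchwartz (v j t)) (htr : TransportEq (Icc 0 T) ψ v) (x : Pt) :
    HasDerivAt (fun τ => vertDensity (ψ τ) x)
      (vertSource (fun j => v j t) (ψ t) x - ∑ j, v j t x * pd j (vertDensity (ψ t)) x) t := by
  have h0 : ∀ y, HasDerivAt (fun τ => ψ τ y)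
      (-1 * ((∑ j, v j t y * pd j (ψ t) y) + v 2 t y)) t := fun y => by
    have h1 := (hψ.hasDerivAt_fderiv ht y).differentiableAt.hasDerivAt
    have h2 := htr t (Ioo_subset_Icc_self ht) y
    exact h1.congr_deriv (by linarith)
  have h1 := hψ.hasDerivAt_pd ht h0 2
  have h2 := (hψ.pd hT 2).hasDerivAt_pd ht h1 2
  have h3 := ((hψ.pd hT 2).pd hT 2).hasDerivAt_pd ht h2 2
  rw [pd_pd_pd_transport hsv hsψ] at h3
  rw [pd_transport hsv hsψ] at h1
  have h4 := ((h1 x).sub (((h1 x).pow 2).const_mul (7 / 2))).mul ((h3 x).pow 2)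
  refine h4.congr_deriv ?_
  simp only [pd_vertDensity hsψ, vertSource, Fin.sum_univ_three]
  push_cast
  simp
  ring

/-! ### Spatial cutoffs -/

theorem HasCompactSupport.isSchwartz {f : Pt → ℝ} (h : HasCompactSupport f)
    (hf : ContDiff ℝ (⊤ : ℕ∞) f) : IsSchwartz f :=
  IsSchwartz.of_map (h.toSchwartzMap hf)

theorem IsSchwartz.exists_supLE {f : Pt → ℝ} (hf : IsSchwartz f) : ∃ M, SupLE f M := by
  obtain ⟨C, hC⟩ := hf.2 0 0
  exact ⟨C, fun x => by simpa using hC x⟩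

theorem exists_cutoff : ∃ (χ : ℕ → Pt → ℝ) (M : ℝ), (∀ n, IsSchwartz (χ n) ∧
    HasCompactSupport (χ n) ∧ SupLE (χ n) 1 ∧ ∀ j, SupLE (pd j (χ n)) (M / (n + 1))) ∧
    ∀ x, Tendsto (fun n => χ n x) atTop (nhds 1) := by
  let φ : ContDiffBump (0 : Pt) := ⟨1, 2, one_pos, one_lt_two⟩
  have hφ : IsSchwartz φ := φ.hasCompactSupport.isSchwartz φ.contDiff
  choose M hM using fun j => (hφ.pd j).exists_supLE
  have hpos : ∀ n : ℕ, (0 : ℝ) < ((n : ℝ) + 1)⁻¹ := fun n => by positivity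
  refine ⟨fun n x => φ (((n : ℝ) + 1)⁻¹ • x), ∑ j, M j, fun n => ?_, fun x => ?_⟩
  · have h1 : HasCompactSupport fun x : Pt => φ (((n : ℝ) + 1)⁻¹ • x) :=
      φ.hasCompactSupport.comp_homeomorph (Homeomorph.smulOfNeZero _ (hpos n).ne')
    refine ⟨h1.isSchwartz (φ.contDiff.comp (contDiff_const_smul _)), h1, fun x => ?_,
      fun j x => ?_⟩
    · rw [abs_of_nonneg φ.nonneg]
      exact φ.le_one
    · have h2 : pd j (fun x : Pt => φ (((n : ℝ) + 1)⁻¹ • x)) x =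
          ((n : ℝ) + 1)⁻¹ * pd j φ (((n : ℝ) + 1)⁻¹ • x) := by
        simp only [pd]
        rw [fderiv_comp_smul]
        rfl
      rw [h2, abs_mul, abs_of_pos (hpos n), div_eq_inv_mul]
      exact mul_le_mul_of_nonneg_left ((hM j _).trans
        (Finset.single_le_sum (f := M) (fun j _ => (hM j).nonneg) (Finset.mem_univ j))) (hpos n).le
  · have h3 : Tendsto (fun n : ℕ => ((n : ℝ) + 1)⁻¹ • x) atTop (nhds ((0 : ℝ) • x)) :=
      (tendsto_inv_atTop_zero.comp
        (tendsto_atTop_add_const_right _ _ tendsto_natCast_atTop_atTop)).smul_const x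
    rw [zero_smul] at h3
    refine tendsto_const_nhds.congr' ?_
    filter_upwards [h3.eventually (Metric.closedBall_mem_nhds (0 : Pt) one_pos)] with n hn
    exact (φ.one_of_mem_closedBall hn).symm

theorem AbsLE.abs_integral_weight_le {w f : Pt → ℝ} {m N : ℝ} (hf : AbsLE f N) (hw : IsSchwartz w)
    (hm : SupLE w m) : |∫ x, w x * f x| ≤ m * N := by
  rcases hm.nonneg.eq_or_lt with h0 | h0
  · have h1 : ∀ x, w x = 0 := fun x => abs_nonpos_iff.1 (h0 ▸ hm x)
    simp [h1, ← h0]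
  · have h1 : IsMult fun x => m⁻¹ * w x := by
      refine ⟨fun g hg => (hw.const_mul m⁻¹).mul hg, fun x => ?_⟩
      rw [abs_mul, abs_of_pos (inv_pos.2 h0), inv_mul_le_iff₀ h0, mul_one]
      exact hm x
    have h2 := hf.2 _ h1
    simp only [mul_assoc, integral_const_mul] at h2
    rwa [abs_mul, abs_of_pos (inv_pos.2 h0), inv_mul_le_iff₀ h0] at h2

theorem integral_mul_transport {v : Fin 3 → Pt → ℝ} {χ f : Pt → ℝ} (hv : ∀ j, IsSchwartz (v j))
    (hdiv : ∀ x, ∑ i, pd i (v i) x = 0) (hχ : IsSchwartz χ) (hf : IsSchwartz f) :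
    ∫ x, χ x * ∑ j, v j x * pd j f x = -∫ x, (∑ j, pd j χ x * v j x) * f x := by
  have h1 : ∀ j, ∫ x, χ x * v j x * pd j f x =
      -∫ x, (pd j χ x * v j x + χ x * pd j (v j) x) * f x := fun j => by
    rw [integral_pd_mul j (hχ.mul (hv j)) hf, pd_mul j hχ (hv j)]
  simp only [Finset.mul_sum, ← mul_assoc]
  rw [integral_finsetSum _ fun j _ => ((hχ.mul (hv j)).mul (hf.pd j)).integrable]
  simp only [h1, Finset.sum_neg_distrib]
  rw [← integral_finsetSum _ fun j _ => ((((hχ.pd j).mul (hv j)).add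
    (hχ.mul ((hv j).pd j))).mul hf).integrable]
  refine congrArg Neg.neg (integral_congr_ae (.of_forall fun x => ?_))
  simp only
  rw [← Finset.sum_mul, Finset.sum_add_distrib, ← Finset.mul_sum, hdiv x, mul_zero, add_zero]

/-- The time derivative of `∫ χ · vertDensity ψ`. -/
def cutoffRate (χ : Pt → ℝ) (v : Fin 3 → Pt → ℝ) (ψ : Pt → ℝ) : ℝ :=
  ∫ x, χ x * (vertSource v ψ x - ∑ j, v j x * pd j (vertDensity ψ) x)

namespace FlowBounds

variable {v : Fin 3 → Pt → ℝ} {ψ : Pt → ℝ} {A b E m : ℝ} {χ : Pt → ℝ}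

theorem abs_cutoffRate_sub_le (H : FlowBounds v ψ A b E) (hχ : IsSchwartz χ)
    (hm : ∀ j, SupLE (pd j χ) m) :
    |cutoffRate χ v ψ - ∫ x, χ x * vertSource v ψ x| ≤
      3 * (m * (40 * A)) * (10 ^ 4 * (E ^ 3 * (1 + E))) := by
  have hF := H.absLE_vertDensity
  have h1 : IsSchwartz fun x => ∑ j, v j x * pd j (vertDensity ψ) x :=
    IsSchwartz.sum _ fun j => (H.hv j).mul (hF.1.pd j)
  have h2 : IsSchwartz fun x => ∑ j, pd j χ x * v j x :=
    IsSchwartz.sum _ fun j => (hχ.pd j).mul (H.hv j)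
  have h3 : cutoffRate χ v ψ - ∫ x, χ x * vertSource v ψ x =
      ∫ x, (∑ j, pd j χ x * v j x) * vertDensity ψ x := by
    simp only [cutoffRate, mul_sub]
    rw [integral_sub (hχ.mul H.absLE_vertSource.1).integrable (hχ.mul h1).integrable,
      integral_mul_transport H.hv H.div_free hχ hF.1]
    ring
  rw [h3]
  refine hF.abs_integral_weight_le h2 fun x => (Finset.abs_sum_le_sum_abs _ _).trans
    ((Finset.sum_le_sum fun j _ => ((hm j).mul (H.sup_v j (L := []) (by simp))) x).trans ?_)
  simp

theorem abs_cutoffRate_le (H : FlowBounds v ψ A b E) (hχ : IsSchwartz χ) (h1 : SupLE χ 1)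
    (hm : ∀ j, SupLE (pd j χ) m) :
    |cutoffRate χ v ψ| ≤ A * (10 ^ 8 * (E ^ 2 * (1 + E) ^ 3) +
      3 * (m * 40) * (10 ^ 4 * (E ^ 3 * (1 + E)))) := by
  have h2 := H.abs_cutoffRate_sub_le hχ hm
  have h3 := H.absLE_vertSource.abs_integral_weight_le hχ h1
  have h4 := abs_add_le (cutoffRate χ v ψ - ∫ x, χ x * vertSource v ψ x)
    (∫ x, χ x * vertSource v ψ x)
  rw [sub_add_cancel] at h4
  linarith

theorem tendsto_cutoffRate (H : FlowBounds v ψ A b E) {χ : ℕ → Pt → ℝ} {M : ℝ}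
    (hχ : ∀ n, IsSchwartz (χ n)) (h1 : ∀ n, SupLE (χ n) 1)
    (hM : ∀ n j, SupLE (pd j (χ n)) (M / (n + 1)))
    (hlim : ∀ x, Tendsto (fun n => χ n x) atTop (nhds 1)) :
    Tendsto (fun n => cutoffRate (χ n) v ψ) atTop (nhds (∫ x, vertSource v ψ x)) := by
  have hS := H.absLE_vertSource.1
  have h2 : Tendsto (fun n => ∫ x, χ n x * vertSource v ψ x) atTop
      (nhds (∫ x, vertSource v ψ x)) := by
    refine tendsto_integral_filter_of_dominated_convergence (fun x => |vertSource v ψ x|)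
      (.of_forall fun n => ((hχ n).mul hS).integrable.1) (.of_forall fun n => .of_forall fun x => ?_)
      hS.integrable.abs (.of_forall fun x => ?_)
    · rw [norm_mul]
      exact mul_le_of_le_one_left (abs_nonneg _) (h1 n x)
    · simpa using (hlim x).mul_const (vertSource v ψ x)
  have h3 : Tendsto (fun n : ℕ => 3 * (M / ((n : ℝ) + 1) * (40 * A)) *
      (10 ^ 4 * (E ^ 3 * (1 + E)))) atTop (nhds 0) := by
    have h4 : Tendsto (fun n : ℕ => M / ((n : ℝ) + 1)) atTop (nhds 0) :=
      tendsto_const_nhds.div_atTop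
        (tendsto_atTop_add_const_right _ _ tendsto_natCast_atTop_atTop)
    simpa using ((h4.mul_const (40 * A)).const_mul 3).mul_const (10 ^ 4 * (E ^ 3 * (1 + E)))
  have h5 := squeeze_zero_norm (a := fun n : ℕ => _) (f := fun n =>
    cutoffRate (χ n) v ψ - ∫ x, χ n x * vertSource v ψ x) (fun n => H.abs_cutoffRate_sub_le (hχ n) (hM n)) h3
  simpa using h5.add h2

end FlowBounds

/-! ### Integration in time -/

theorem integrable_cutoff_prod {T : ℝ} {h : ℝ → Pt → ℝ} {χ : Pt → ℝ} (hT : 0 ≤ T)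
    (hh : ContinuousOn (fun q : ℝ × Pt => h q.1 q.2) (Icc 0 T ×ˢ univ)) (hχ : Continuous χ)
    (hc : HasCompactSupport χ) :
    Integrable (Function.uncurry fun t x => χ x * h t x)
      ((volume.restrict (uIoc 0 T)).prod volume) := by
  have h1 : IntegrableOn (Function.uncurry fun t x => χ x * h t x) (Icc 0 T ×ˢ tsupport χ)
      (volume.prod volume) :=
    ContinuousOn.integrableOn_compact (isCompact_Icc.prod hc) <|
      ((hχ.comp continuous_snd).continuousOn).mul
        (hh.mono (prod_mono Subset.rfl (subset_univ _)))
  have h2 : IntegrableOn (Function.uncurry fun t x => χ x * h t x) (Icc 0 T ×ˢ univ)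
      (volume.prod volume) := by
    refine h1.of_forall_sdiff_eq_zero (measurableSet_Icc.prod MeasurableSet.univ) fun q hq => ?_
    have h3 : q.2 ∉ tsupport χ := fun h => hq.2 ⟨hq.1.1, h⟩
    simp [Function.uncurry, image_eq_zero_of_notMem_tsupport h3]
  have h4 := h2.mono_set (prod_mono (uIoc_of_le hT ▸ Ioc_subset_Icc_self) Subset.rfl)
  rwa [IntegrableOn, ← Measure.prod_restrict, Measure.restrict_univ] at h4

theorem integral_cutoff_deriv {T : ℝ} {h F : ℝ → Pt → ℝ} {χ : Pt → ℝ} (hT : 0 ≤ T)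
    (hh : ContinuousOn (fun q : ℝ × Pt => h q.1 q.2) (Icc 0 T ×ˢ univ))
    (hF : ∀ x, ContinuousOn (fun t => F t x) (Icc 0 T))
    (hd : ∀ t ∈ Ioo 0 T, ∀ x, HasDerivAt (fun τ => F τ x) (h t x) t) (hχ : Continuous χ)
    (hc : HasCompactSupport χ) :
    ∫ t in (0 : ℝ)..T, ∫ x, χ x * h t x = ∫ x, χ x * (F T x - F 0 x) := by
  rw [intervalIntegral_integral_swap (integrable_cutoff_prod hT hh hχ hc)]
  refine integral_congr_ae (.of_forall fun x => ?_)
  have h1 : ContinuousOn (fun t => h t x) (Icc 0 T) :=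
    hh.comp (f := fun t : ℝ => (t, x)) (by fun_prop) fun t ht => ⟨ht, mem_univ _⟩
  simp only [intervalIntegral.integral_const_mul]
  rw [intervalIntegral.integral_eq_sub_of_hasDerivAt_of_le hT (hF x) (fun t ht => hd t ht x)
    (h1.intervalIntegrable_of_Icc hT)]

theorem continuousOn_vertRhs {T : ℝ} {ψ : ℝ → Pt → ℝ} {v : Fin 3 → ℝ → Pt → ℝ} (hT : 0 < T)
    (hψ : SmoothOn2 (Icc 0 T) ψ) (hv : ∀ j, SmoothOn2 (Icc 0 T) (v j))
    (hs : ∀ t ∈ Icc 0 T, IsSchwartz (ψ t)) :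
    ContinuousOn (fun q : ℝ × Pt => vertSource (fun j => v j q.1) (ψ q.1) q.2 -
      ∑ j, v j q.1 q.2 * pd j (vertDensity (ψ q.1)) q.2) (Icc 0 T ×ˢ univ) := by
  have c : ∀ {f : ℝ → Pt → ℝ}, SmoothOn2 (Icc 0 T) f →
      ContinuousOn (fun q : ℝ × Pt => f q.1 q.2) (Icc 0 T ×ˢ univ) := fun hf =>
    ContDiffOn.continuousOn hf
  have s1 := hψ.pd hT 2
  have s3 := (s1.pd hT 2).pd hT 2
  have c0 := fun j => c (hψ.pd hT j)
  have c1 := c s1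
  have c1' := fun j => c (s1.pd hT j)
  have c2 := fun j => c ((s1.pd hT 2).pd hT j)
  have c3 := c s3
  have c3' := fun j => c (s3.pd hT j)
  have d0 := fun j => c (hv j)
  have d1 := fun j => c ((hv j).pd hT 2)
  have d2 := fun j => c (((hv j).pd hT 2).pd hT 2)
  have d3 := fun j => c ((((hv j).pd hT 2).pd hT 2).pd hT 2)
  have a1 : ContinuousOn (fun q : ℝ × Pt => (1 - 7 * pd 2 (ψ q.1) q.2) *
      pd 2 (pd 2 (pd 2 (ψ q.1))) q.2 ^ 2) (Icc 0 T ×ˢ univ) :=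
    (continuousOn_const.sub (continuousOn_const.mul c1)).mul (c3.pow 2)
  have a2 : ContinuousOn (fun q : ℝ × Pt => 2 * (pd 2 (ψ q.1) q.2 - 7 / 2 * pd 2 (ψ q.1) q.2 ^ 2) *
      pd 2 (pd 2 (pd 2 (ψ q.1))) q.2) (Icc 0 T ×ˢ univ) :=
    (continuousOn_const.mul (c1.sub (continuousOn_const.mul (c1.pow 2)))).mul c3
  have r1 : ContinuousOn (fun q : ℝ × Pt => vertRate₁ (fun j => v j q.1) (ψ q.1) q.2)
      (Icc 0 T ×ˢ univ) :=
    (continuousOn_finsetSum _ fun j _ => (d1 j).mul (c0 j)).neg.sub (d1 2)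
  have r3 : ContinuousOn (fun q : ℝ × Pt => vertRate₃ (fun j => v j q.1) (ψ q.1) q.2)
      (Icc 0 T ×ˢ univ) :=
    (continuousOn_finsetSum _ fun j _ => (((d3 j).mul (c0 j)).add
      (continuousOn_const.mul ((d2 j).mul (c1' j)))).add
      (continuousOn_const.mul ((d1 j).mul (c2 j)))).neg.sub (d3 2)
  have h1 := ((a1.mul r1).add (a2.mul r3)).sub
    (continuousOn_finsetSum Finset.univ fun j _ => (d0 j).mul
      ((a1.mul (c1' j)).add (a2.mul (c3' j))))
  refine h1.congr fun q hq => ?_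
  simp only [pd_vertDensity (hs q.1 hq.1), vertSource, Pi.add_apply, Pi.sub_apply, Pi.mul_apply]

/-! ### The cubic vertical term integrated in time -/

theorem integral_vertSource_time {T B : ℝ} {ψ : ℝ → Pt → ℝ} {v : Fin 3 → ℝ → Pt → ℝ}
    {A b : ℝ → ℝ} (hT : 0 < T) (hψ : SmoothOn2 (Icc 0 T) ψ)
    (hv : ∀ j, SmoothOn2 (Icc 0 T) (v j)) (htr : TransportEq (Icc 0 T) ψ v)
    (H : ∀ t ∈ Icc 0 T, FlowBounds (fun j => v j t) (ψ t) (A t) (b t) B)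
    (hA : IntervalIntegrable A volume 0 T) :
    IntervalIntegrable (fun t => ∫ x, vertSource (fun j => v j t) (ψ t) x) volume 0 T ∧
      |∫ t in (0 : ℝ)..T, ∫ x, vertSource (fun j => v j t) (ψ t) x| ≤
        2 * 10 ^ 4 * (B ^ 3 * (1 + B)) := by
  obtain ⟨χ, M, hχ, hlim⟩ := exists_cutoff
  have hsub : uIoc 0 T ⊆ Icc 0 T := uIoc_of_le hT.le ▸ Ioc_subset_Icc_self
  have hae : ∀ᵐ t ∂volume.restrict (uIoc 0 T), t ∈ uIoc 0 T :=
    ae_restrict_mem measurableSet_uIoc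
  have h0 : (0 : ℝ) ∈ Icc 0 T := left_mem_Icc.2 hT.le
  have hT' : T ∈ Icc 0 T := right_mem_Icc.2 hT.le
  have hB := (H 0 h0).E_nonneg
  have hM : 0 ≤ M := by simpa using ((hχ 0).2.2.2 0).nonneg
  have hcont := continuousOn_vertRhs hT hψ hv fun t ht => (H t ht).hψ
  have hmeas : ∀ n, AEStronglyMeasurable
      (fun t => cutoffRate (χ n) (fun j => v j t) (ψ t)) (volume.restrict (uIoc 0 T)) := fun n =>
    (integrable_cutoff_prod (h := fun t x => vertSource (fun j => v j t) (ψ t) x -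
      ∑ j, v j t x * pd j (vertDensity (ψ t)) x) hT.le hcont (hχ n).1.continuous
      (hχ n).2.1).integral_prod_left.aestronglyMeasurable
  have hpt : ∀ t ∈ Icc 0 T, Tendsto (fun n => cutoffRate (χ n) (fun j => v j t) (ψ t)) atTop
      (nhds (∫ x, vertSource (fun j => v j t) (ψ t) x)) := fun t ht =>
    (H t ht).tendsto_cutoffRate (fun n => (hχ n).1) (fun n => (hχ n).2.2.1)
      (fun n => (hχ n).2.2.2) hlim
  have hbound : ∀ n, ∀ t ∈ Icc 0 T, ‖cutoffRate (χ n) (fun j => v j t) (ψ t)‖ ≤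
      A t * (10 ^ 8 * (B ^ 2 * (1 + B) ^ 3) + 3 * (M * 40) * (10 ^ 4 * (B ^ 3 * (1 + B)))) :=
    fun n t ht => (H t ht).abs_cutoffRate_le (hχ n).1 (hχ n).2.2.1 fun j x =>
      ((hχ n).2.2.2 j x).trans (div_le_self hM (by linarith [n.cast_nonneg (α := ℝ)]))
  have hlimT := intervalIntegral.tendsto_integral_filter_of_dominated_convergence _
    (.of_forall hmeas) (.of_forall fun n => .of_forall fun t ht => hbound n t (hsub ht))
    (hA.mul_const _) (.of_forall fun t ht => hpt t (hsub ht))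
  have hmeas' := aestronglyMeasurable_of_tendsto_ae atTop hmeas
    (hae.mono fun t ht => hpt t (hsub ht))
  refine ⟨?_, ?_⟩
  · rw [intervalIntegrable_iff]
    refine (intervalIntegrable_iff.1 (hA.mul_const (10 ^ 8 * (B ^ 2 * (1 + B) ^ 3)))).mono' hmeas'
      (hae.mono fun t ht => ?_)
    have h1 := (H t (hsub ht)).absLE_vertSource.abs_integral_le
    rw [Real.norm_eq_abs]
    linarith
  · refine le_of_tendsto hlimT.abs (.of_forall fun n => ?_)
    have hFs : ∀ t ∈ Icc 0 T, AbsLE (vertDensity (ψ t)) (10 ^ 4 * (B ^ 3 * (1 + B))) :=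
      fun t ht => (H t ht).absLE_vertDensity
    have hFc : ∀ x, ContinuousOn (fun t => vertDensity (ψ t) x) (Icc 0 T) := fun x => by
      have s1 := hψ.pd hT 2
      have c1 := s1.continuousOn x
      have c3 := ((s1.pd hT 2).pd hT 2).continuousOn x
      exact (c1.sub (continuousOn_const.mul (c1.pow 2))).mul (c3.pow 2)
    have h1 := integral_cutoff_deriv (h := fun t x => vertSource (fun j => v j t) (ψ t) x -
      ∑ j, v j t x * pd j (vertDensity (ψ t)) x) hT.le hcont hFc
      (fun t ht x => hasDerivAt_vertDensity hT hψ ht (H t (Ioo_subset_Icc_self ht)).hψ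
        (H t (Ioo_subset_Icc_self ht)).hv htr x) (hχ n).1.continuous (hχ n).2.1
    have h2 : ∫ t in (0 : ℝ)..T, cutoffRate (χ n) (fun j => v j t) (ψ t) =
        (∫ x, χ n x * vertDensity (ψ T) x) - ∫ x, χ n x * vertDensity (ψ 0) x := by
      rw [← integral_sub ((hχ n).1.mul (hFs T hT').1).integrable
        ((hχ n).1.mul (hFs 0 h0).1).integrable]
      simp only [← mul_sub]
      exact h1
    have h3 := (hFs T hT').abs_integral_weight_le (hχ n).1 (hχ n).2.2.1
    have h4 := (hFs 0 h0).abs_integral_weight_le (hχ n).1 (hχ n).2.2.1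
    rw [h2]
    exact (abs_sub _ _).trans (by linarith)

/-! ### The final estimate -/

theorem FlowBounds.mono_right {v : Fin 3 → Pt → ℝ} {ψ : Pt → ℝ} {A b E E' : ℝ}
    (H : FlowBounds v ψ A b E) (h : E ≤ E') : FlowBounds v ψ A b E' :=
  { H with
    b_le := H.b_le.trans h
    l2_ψ := fun L h1 h2 => (H.l2_ψ L h1 h2).mono h }

theorem l2T_sqrt_sq {T : ℝ} {g : ℝ → ℝ} (hT : 0 ≤ T) (hg : ∀ t, 0 ≤ g t) :
    (l2T T fun t => √(g t)) ^ 2 = ∫ t in (0 : ℝ)..T, g t := by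
  simp only [l2T, sq_sqrt (hg _)]
  exact sq_sqrt (intervalIntegral.integral_nonneg hT fun t _ => hg t)

theorem integral_add_le_BT_sq {T : ℝ} {ψ : ℝ → Pt → ℝ} {v : Fin 3 → ℝ → Pt → ℝ} (hT : 0 ≤ T) :
    (∫ t in (0 : ℝ)..T, gradVecHSq 2 fun j => v j t) + ∫ t in (0 : ℝ)..T, gradHHSq 1 (ψ t) ≤
      BT T ψ v ^ 2 := by
  rw [BT, BTsq, sq_sqrt (by positivity), l2T_sqrt_sq hT fun t => gradVecHSq_nonneg 2 _,
    l2T_sqrt_sq hT fun t => gradHHSq_nonneg 1 _]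
  nlinarith [sq_nonneg (supT T fun t => √(vecHSq 2 fun j => v j t)),
    sq_nonneg (supT T fun t => √(gradHSq 2 (ψ t)))]

theorem sqrt_gradHSq_le_BT {T : ℝ} {ψ : ℝ → Pt → ℝ} {v : Fin 3 → ℝ → Pt → ℝ}
    (h : FiniteClass T ψ v) {t : ℝ} (ht : t ∈ Icc 0 T) : √(gradHSq 2 (ψ t)) ≤ BT T ψ v := by
  have h1 : √(gradHSq 2 (ψ t)) ≤ supT T fun t => √(gradHSq 2 (ψ t)) :=
    le_csSup h.2.1 (mem_image_of_mem _ ht)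
  refine h1.trans (Real.le_sqrt_of_sq_le ?_)
  rw [BTsq]
  nlinarith [sq_nonneg (supT T fun t => √(vecHSq 2 fun j => v j t)),
    sq_nonneg (l2T T fun t => √(gradVecHSq 2 fun j => v j t)),
    sq_nonneg (l2T T fun t => √(gradHHSq 1 (ψ t)))]

theorem intervalIntegrable_sqrt {a b : ℝ} {g : ℝ → ℝ} (hg : ∀ t, 0 ≤ g t)
    (h : IntervalIntegrable g volume a b) : IntervalIntegrable (fun t => √(g t)) volume a b := by
  rw [intervalIntegrable_iff] at h ⊢
  refine (h.add (intervalIntegrable_iff.1 (intervalIntegrable_const (c := (1 : ℝ))))).mono'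
    (continuous_sqrt.comp_aestronglyMeasurable h.aestronglyMeasurable) (.of_forall fun t => ?_)
  rw [Real.norm_eq_abs, abs_of_nonneg (sqrt_nonneg _), Pi.add_apply]
  nlinarith [sq_sqrt (hg t), sq_nonneg (√(g t) - 1)]

theorem FlowBounds.abs_hInner_sub_le {v : Fin 3 → Pt → ℝ} {ψ : Pt → ℝ} {A b E : ℝ}
    (H : FlowBounds v ψ A b E) :
    |hInner 2 (fun x => ∑ j, v j x * pd j ψ x) (lapl ψ) -
        vertCount * ∫ x, vertSource v ψ x| ≤
      ((midx 2).card * 6000 + |vertCount| * (2 * 10 ^ 7)) * (A * b * E * (1 + E) ^ 2) := by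
  have h1 := H.abs_hInner_le
  have h2 := mul_le_mul_of_nonneg_left H.abs_integral_vertSource_add_le (abs_nonneg vertCount)
  rw [← abs_mul] at h2
  have h3 : (midx 2).card * 6000 * (A * b * E) ≤
      (midx 2).card * 6000 * (A * b * E * (1 + E) ^ 2) := by
    refine mul_le_mul_of_nonneg_left (le_mul_of_one_le_right ?_ ?_) (by positivity)
    · exact mul_nonneg (mul_nonneg H.A_nonneg H.b_nonneg) H.E_nonneg
    · exact one_le_pow₀ (by linarith [H.E_nonneg])
  set I := hInner 2 (fun x => ∑ j, v j x * pd j ψ x) (lapl ψ)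
  set S := ∫ x, vertSource v ψ x
  set R := ∫ x, pd 2 (v 2) x * pd 2 (pd 2 (pd 2 ψ)) x * pd 2 (pd 2 (pd 2 ψ)) x
  have h4 : I - vertCount * S = (I + vertCount * R) - vertCount * (S + R) := by ring
  rw [h4]
  exact (abs_sub _ _).trans (by linarith)

/-- The estimate `I₂`: `|∫₀^T (v·∇ψ|Δψ)_{H²} dt| ≤ C B_T³ (1 + B_T)²`. -/
theorem stmt_16 :
    ∃ C : ℝ, 0 < C ∧ ∀ T : ℝ, 0 < T → ∀ (ψ : ℝ → Pt → ℝ) (v : Fin 3 → ℝ → Pt → ℝ),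
      SmoothOn2 (Icc 0 T) ψ → (∀ j, SmoothOn2 (Icc 0 T) (v j)) →
      (∀ t ∈ Icc (0:ℝ) T, IsSchwartz (ψ t) ∧ ∀ j, IsSchwartz (v j t)) →
      DivFree (Icc 0 T) v → TransportEq (Icc 0 T) ψ v → FiniteClass T ψ v →
      |∫ t in (0:ℝ)..T, hInner 2 (fun x => ∑ i, v i t x * pd i (ψ t) x) (lapl (ψ t))| ≤
        C * BT T ψ v ^ 3 * (1 + BT T ψ v) ^ 2 := by
  set K : ℝ := (midx 2).card * 6000 + |vertCount| * (2 * 10 ^ 7)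
  have hK0 : 0 ≤ K := by positivity
  refine ⟨K + |vertCount| * (2 * 10 ^ 4) + 1, by positivity, ?_⟩
  intro T hT ψ v hψ hv hs hdiv htr hfin
  set B := BT T ψ v
  have hB0 : 0 ≤ B := sqrt_nonneg _
  set I : ℝ → ℝ := fun t => hInner 2 (fun x => ∑ i, v i t x * pd i (ψ t) x) (lapl (ψ t))
  set S : ℝ → ℝ := fun t => ∫ x, vertSource (fun j => v j t) (ψ t) x
  by_cases hI : IntervalIntegrable I volume 0 T
  swap
  · rw [intervalIntegral.integral_undef hI, abs_zero]
    positivity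
  have H : ∀ t ∈ Icc 0 T, FlowBounds (fun j => v j t) (ψ t) √(gradVecHSq 2 fun j => v j t)
      (min √(gradHHSq 1 (ψ t)) √(gradHSq 2 (ψ t))) B := fun t ht =>
    (flowBounds_of_isSchwartz (hs t ht).2 (hs t ht).1 (hdiv t ht)).mono_right
      (sqrt_gradHSq_le_BT hfin ht)
  obtain ⟨hSint, hSle⟩ := integral_vertSource_time hT hψ hv htr H
    (intervalIntegrable_sqrt (fun t => gradVecHSq_nonneg 2 _) hfin.2.2.1)
  have hrem : ∀ t ∈ Icc 0 T, |I t - vertCount * S t| ≤ K * (B * (1 + B) ^ 2) / 2 *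
      (gradVecHSq 2 (fun j => v j t) + gradHHSq 1 (ψ t)) := fun t ht => by
    refine (H t ht).abs_hInner_sub_le.trans ?_
    have h1 := sq_sqrt (gradVecHSq_nonneg 2 fun j => v j t)
    have h2 := sq_sqrt (gradHHSq_nonneg 1 (ψ t))
    set a := √(gradVecHSq 2 fun j => v j t)
    set c := √(gradHHSq 1 (ψ t))
    have h3 : a * min c √(gradHSq 2 (ψ t)) ≤ (a ^ 2 + c ^ 2) / 2 :=
      (mul_le_mul_of_nonneg_left (min_le_left _ _) (sqrt_nonneg _)).trans
        (by linarith [two_mul_le_add_sq a c])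
    rw [← h1, ← h2]
    have h4 := mul_le_mul_of_nonneg_left h3 (show 0 ≤ K * (B * (1 + B) ^ 2) by positivity)
    linarith
  have hsum := hfin.2.2.1.add hfin.2.2.2
  have h1 := intervalIntegral.abs_integral_le_integral_abs (f := fun t => I t - vertCount * S t)
    (μ := volume) hT.le
  have h2 := intervalIntegral.integral_mono_on hT.le (hI.sub (hSint.const_mul vertCount)).abs
    (hsum.const_mul (K * (B * (1 + B) ^ 2) / 2)) hrem
  rw [intervalIntegral.integral_const_mul] at h2
  rw [intervalIntegral.integral_add hfin.2.2.1 hfin.2.2.2] at h2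
  rw [intervalIntegral.integral_sub hI (hSint.const_mul vertCount),
    intervalIntegral.integral_const_mul] at h1
  have h3 := mul_le_mul_of_nonneg_left (integral_add_le_BT_sq (ψ := ψ) (v := v) hT.le)
    (show 0 ≤ K * (B * (1 + B) ^ 2) / 2 by positivity)
  have h4 := mul_le_mul_of_nonneg_left hSle (abs_nonneg vertCount)
  rw [← abs_mul] at h4
  have h5 := abs_add_le ((∫ t in (0 : ℝ)..T, I t) - vertCount * ∫ t in (0 : ℝ)..T, S t)
    (vertCount * ∫ t in (0 : ℝ)..T, S t)
  rw [sub_add_cancel] at h5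
  have h6 : 0 ≤ |vertCount| * (2 * 10 ^ 4) * (B ^ 3 * ((1 + B) * B)) := by positivity
  have h7 : 0 ≤ K * B ^ 3 * (1 + B) ^ 2 := by positivity
  have h8 : 0 ≤ B ^ 3 * (1 + B) ^ 2 := by positivity
  nlinarith

end
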